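/- arXiv:1603.04193 — 2 statements merged into one kernel-verified Lean document; each statement's English description precedes it below -/
import Mathlib

section
/- Let X ⊆ ℝⁿ be a real algebraic set, let f be a regulous function on X and set S = S(f) = {x ∈ X : f(x) > 0}. Then there exists a polynomial function r on X such that S(r) ⊆ S and S \ S(r) ⊆ Zar(Bd(S)) ∩ pol(f), where Zar(Bd(S)) denotes the Zariski closure in X of the euclidean boundary Bd(S) of S. -/
open MvPolynomial Set

/-- A real algebraic set: the common zero locus of finitely many real polynomials. -/
def IsRealAlgebraicSet {n : ℕ} (X : Set (Fin n → ℝ)) : Prop :=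
  ∃ (k : ℕ) (p : Fin k → MvPolynomial (Fin n) ℝ),
    X = {x | ∀ i, MvPolynomial.eval x (p i) = 0}

/-- `V` is a real algebraic subset of `X`, i.e. a Zariski closed subset of `X`. -/
def IsZariskiClosedIn {n : ℕ} (X V : Set (Fin n → ℝ)) : Prop :=
  IsRealAlgebraicSet V ∧ V ⊆ X

/-- `U` is a Zariski open subset of `X`. -/
def IsZariskiOpenIn {n : ℕ} (X U : Set (Fin n → ℝ)) : Prop :=
  U ⊆ X ∧ IsRealAlgebraicSet (X \ U)

/-- `U` is Zariski dense in `X`. -/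
def IsZariskiDenseIn {n : ℕ} (X U : Set (Fin n → ℝ)) : Prop :=
  ∀ V, IsZariskiClosedIn X V → U ⊆ V → V = X

/-- `f` is regular on `U` : on `U`, `f = p / q` with `q` nonvanishing on `U`. -/
def IsRegularOnSet {n : ℕ} (U : Set (Fin n → ℝ)) (f : (Fin n → ℝ) → ℝ) : Prop :=
  ∃ p q : MvPolynomial (Fin n) ℝ,
    (∀ x ∈ U, MvPolynomial.eval x q ≠ 0) ∧
    ∀ x ∈ U, f x = MvPolynomial.eval x p / MvPolynomial.eval x q

/-- A rational continuous function on `X`: continuous on `X` (euclidean topology) and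
regular on a Zariski-dense Zariski-open subset of `X`. -/
def IsRatCont {n : ℕ} (X : Set (Fin n → ℝ)) (f : (Fin n → ℝ) → ℝ) : Prop :=
  ContinuousOn f X ∧
    ∃ U, IsZariskiOpenIn X U ∧ IsZariskiDenseIn X U ∧ IsRegularOnSet U f

/-- A regulous function on `ℝⁿ`: continuous, and equal to a quotient of polynomials on a
nonempty Zariski open subset of `ℝⁿ`. -/
def IsRegulous {n : ℕ} (f : (Fin n → ℝ) → ℝ) : Prop :=
  Continuous f ∧
    ∃ U : Set (Fin n → ℝ), IsZariskiOpenIn Set.univ U ∧ U.Nonempty ∧ IsRegularOnSet U f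

/-- A regulous function on `X`: the restriction to `X` of a regulous function on `ℝⁿ`. -/
def IsRegulousOn {n : ℕ} (X : Set (Fin n → ℝ)) (f : (Fin n → ℝ) → ℝ) : Prop :=
  ∃ g : (Fin n → ℝ) → ℝ, IsRegulous g ∧ ∀ x ∈ X, f x = g x

/-- The largest Zariski open subset of `X` on which `f` is regular. -/
def regularDomain {n : ℕ} (X : Set (Fin n → ℝ)) (f : (Fin n → ℝ) → ℝ) : Set (Fin n → ℝ) :=
  ⋃₀ {U | IsZariskiOpenIn X U ∧ IsRegularOnSet U f}

/-- The polar locus of `f` on `X`. -/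
def polarLocus {n : ℕ} (X : Set (Fin n → ℝ)) (f : (Fin n → ℝ) → ℝ) : Set (Fin n → ℝ) :=
  X \ regularDomain X f

/-- The ideal of polynomials vanishing on `X`. -/
noncomputable def vanishingIdealOf {n : ℕ} (X : Set (Fin n → ℝ)) : Ideal (MvPolynomial (Fin n) ℝ) where
  carrier := {p | ∀ x ∈ X, MvPolynomial.eval x p = 0}
  add_mem' := by
    intro a b ha hb x hx
    simp [map_add, ha x hx, hb x hx]
  zero_mem' := by intro x hx; simp
  smul_mem' := by
    intro c p hp x hx
    simp [smul_eq_mul, map_mul, hp x hx]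

/-- The dimension of `X`: the Krull dimension of its coordinate ring. -/
noncomputable def algDim {n : ℕ} (X : Set (Fin n → ℝ)) : WithBot ℕ∞ :=
  ringKrullDim (MvPolynomial (Fin n) ℝ ⧸ vanishingIdealOf X)

/-- `x` is a regular (nonsingular) point of `X`: locally around `x`, `X` is the common zero
set of `n - d` polynomials (`d = dim X`) whose gradients at `x` are linearly independent. -/
def IsRegularPoint {n : ℕ} (X : Set (Fin n → ℝ)) (x : Fin n → ℝ) : Prop :=
  x ∈ X ∧ ∃ d : ℕ, algDim X = (d : WithBot ℕ∞) ∧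
    ∃ (p : Fin (n - d) → MvPolynomial (Fin n) ℝ) (U : Set (Fin n → ℝ)),
      IsOpen U ∧ x ∈ U ∧
      X ∩ U = {y ∈ U | ∀ j, MvPolynomial.eval y (p j) = 0} ∧
      LinearIndependent ℝ fun j : Fin (n - d) =>
        fun i : Fin n => MvPolynomial.eval x (MvPolynomial.pderiv i (p j))

/-- `X` is central: it is the euclidean closure of its set of regular points. -/
def IsCentral {n : ℕ} (X : Set (Fin n → ℝ)) : Prop :=
  closure {x | IsRegularPoint X x} = X

/-- A semi-algebraic subset of `ℝᵐ`: a finite union of sets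
`{x | p x = 0, q₁ x > 0, …, q_k x > 0}`. -/
def IsSemialgebraic {m : ℕ} (S : Set (Fin m → ℝ)) : Prop :=
  ∃ (N : ℕ) (P : Fin N → MvPolynomial (Fin m) ℝ) (k : Fin N → ℕ)
    (Q : (i : Fin N) → Fin (k i) → MvPolynomial (Fin m) ℝ),
    S = ⋃ i, {x | MvPolynomial.eval x (P i) = 0 ∧ ∀ j, 0 < MvPolynomial.eval x (Q i j)}

/-- The graph of `f : X → ℝ`, as a subset of `ℝⁿ⁺¹`. -/
def graphOn {n : ℕ} (X : Set (Fin n → ℝ)) (f : (Fin n → ℝ) → ℝ) : Set (Fin (n + 1) → ℝ) :=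
  {y | (fun i : Fin n => y i.castSucc) ∈ X ∧ y (Fin.last n) = f fun i : Fin n => y i.castSucc}

/-- `f` is a semi-algebraic function on `X`: its graph is semi-algebraic in `ℝⁿ⁺¹`. -/
def IsSemialgebraicFnOn {n : ℕ} (X : Set (Fin n → ℝ)) (f : (Fin n → ℝ) → ℝ) : Prop :=
  IsSemialgebraic (graphOn X f)

/-- The interior of `S` in `X` for the euclidean topology of `X`. -/
def interiorIn {n : ℕ} (X S : Set (Fin n → ℝ)) : Set (Fin n → ℝ) :=
  {x ∈ X | ∃ U, IsOpen U ∧ x ∈ U ∧ U ∩ X ⊆ S}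

/-- The euclidean boundary of `S` in `X`: closure of `S` in `X` minus interior of `S` in `X`. -/
def bdIn {n : ℕ} (X S : Set (Fin n → ℝ)) : Set (Fin n → ℝ) :=
  (closure S ∩ X) \ interiorIn X S

/-- The Zariski closure of `E` in `X`: the smallest real algebraic subset of `X`
containing `E`. -/
def zarClosureIn {n : ℕ} (X E : Set (Fin n → ℝ)) : Set (Fin n → ℝ) :=
  ⋂₀ {V | IsZariskiClosedIn X V ∧ E ⊆ V}

/-- `V` is a regulous closed subset of `X`: the zero set of a regulous function on `X`. -/
def IsRegulousClosedIn {n : ℕ} (X V : Set (Fin n → ℝ)) : Prop :=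
  ∃ f : (Fin n → ℝ) → ℝ, IsRegulousOn X f ∧ V = {x ∈ X | f x = 0}

/-- The regulous closure of `E` in `X`: the smallest regulous closed subset of `X`
containing `E`. -/
def regClosureIn {n : ℕ} (X E : Set (Fin n → ℝ)) : Set (Fin n → ℝ) :=
  ⋂₀ {V | IsRegulousClosedIn X V ∧ E ⊆ V}

/-- `X` is an irreducible real algebraic set: it is not the union of two proper real
algebraic subsets. -/
def IsIrreducibleAlgSet {n : ℕ} (X : Set (Fin n → ℝ)) : Prop :=
  IsRealAlgebraicSet X ∧
    ∀ V W : Set (Fin n → ℝ), IsZariskiClosedIn X V → IsZariskiClosedIn X W →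
      X = V ∪ W → V = X ∨ W = X


/-- Dual numbers without inherited algebra structures. -/
def DN (L : Type) [Field L] : Type := DualNumber L

noncomputable instance (L : Type) [Field L] : CommRing (DN L) :=
  inferInstanceAs (CommRing (DualNumber L))

lemma exists_lift_dual {S L : Type} [CommRing S] [IsDomain S] [Field L] [CharZero L]
    [Algebra ℝ S] [Algebra ℝ L] [Algebra.EssFiniteType ℝ L]
    [Algebra S L] [IsScalarTower ℝ S L] (hinj : Function.Injective (algebraMap S L))
    (θ : S →+* DualNumber L) (hθ : ∀ s, (θ s).fst = algebraMap S L s) :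
    ∃ ψ : L →+* DualNumber L, (∀ x, (ψ x).fst = x) ∧ ∀ s, ψ (algebraMap S L s) = θ s := by
  have : FaithfulSMul S L := (faithfulSMul_iff_algebraMap_injective S L).2 hinj
  let : Algebra (FractionRing S) L := FractionRing.liftAlgebra S L
  have : IsScalarTower S (FractionRing S) L := inferInstance
  have : IsScalarTower ℝ (FractionRing S) L := IsScalarTower.of_algebraMap_eq (fun x => by
    rw [IsScalarTower.algebraMap_apply ℝ S L, IsScalarTower.algebraMap_apply ℝ S (FractionRing S),
      ← IsScalarTower.algebraMap_apply S (FractionRing S) L])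
  have : CharZero (FractionRing S) :=
    charZero_of_injective_algebraMap (algebraMap ℝ (FractionRing S)).injective
  have : Algebra.EssFiniteType (FractionRing S) L := Algebra.EssFiniteType.of_comp ℝ _ _
  have : Algebra.FormallySmooth S (FractionRing S) := .of_isLocalization (nonZeroDivisors S)
  have : Algebra.FormallySmooth (FractionRing S) L := inferInstance
  have : Algebra.FormallySmooth S L := .comp S (FractionRing S) L
  let : Algebra S (DN L) := RingHom.toAlgebra (S := DN L) θ
  let g : DN L →ₐ[S] L := { (TrivSqZeroExt.fstHom L L L).toRingHom with
    commutes' := fun s => hθ s }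
  have hg : Function.Surjective g := fun x => ⟨(TrivSqZeroExt.inl x : DualNumber L), rfl⟩
  have hk : IsNilpotent (RingHom.ker (g : DN L →+* L)) := by
    refine ⟨2, ?_⟩
    rw [pow_two, Ideal.zero_eq_bot, eq_bot_iff, Ideal.mul_le]
    intro r hr s hs
    have hr' : TrivSqZeroExt.fst (R := L) (M := L) r = 0 := hr
    have hs' : TrivSqZeroExt.fst (R := L) (M := L) s = 0 := hs
    show r * s = 0
    apply TrivSqZeroExt.ext
    · show TrivSqZeroExt.fst (R := L) (M := L) r * TrivSqZeroExt.fst (R := L) (M := L) s = 0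
      rw [hr', zero_mul]
    · show TrivSqZeroExt.fst (R := L) (M := L) r • TrivSqZeroExt.snd (R := L) (M := L) s +
        MulOpposite.op (TrivSqZeroExt.fst (R := L) (M := L) s) • TrivSqZeroExt.snd (R := L) (M := L) r = 0
      rw [hr', hs']; simp
  let ψ := Algebra.FormallySmooth.liftOfSurjective (AlgHom.id S L) g hg hk
  refine ⟨(ψ : L →+* DN L), ?_, ?_⟩
  · intro x
    exact Algebra.FormallySmooth.liftOfSurjective_apply (AlgHom.id S L) g hg hk x
  · intro s
    exact ψ.commutes s

open Polynomial in
lemma exists_derivation {L : Type} [Field L] [Algebra ℝ L] [Algebra.EssFiniteType ℝ L]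
    (u φ : L) (hind : ∀ P : ℝ[X][X], eval₂ (aeval u : ℝ[X] →ₐ[ℝ] L).toRingHom φ P = 0 → P = 0) :
    ∃ D : Derivation ℝ L L, D u = 0 ∧ D φ = 1 := by
  have : CharZero L := charZero_of_injective_algebraMap (algebraMap ℝ L).injective
  let : Algebra ℝ[X][X] L := (eval₂RingHom (aeval u : ℝ[X] →ₐ[ℝ] L).toRingHom φ).toAlgebra
  have hmap : ∀ P, algebraMap ℝ[X][X] L P = eval₂ (aeval u : ℝ[X] →ₐ[ℝ] L).toRingHom φ P :=
    fun P => rfl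
  have : IsScalarTower ℝ ℝ[X][X] L := IsScalarTower.of_algebraMap_eq (fun x => by
    rw [hmap, Polynomial.algebraMap_apply, Polynomial.algebraMap_apply]; simp)
  let θ : ℝ[X][X] →+* DualNumber L :=
    eval₂RingHom ((TrivSqZeroExt.inlHom L L).comp (aeval u : ℝ[X] →ₐ[ℝ] L).toRingHom)
      (TrivSqZeroExt.inl φ + TrivSqZeroExt.inr 1)
  have hθ : ∀ s, (θ s).fst = algebraMap ℝ[X][X] L s := by
    intro s
    have : ((TrivSqZeroExt.fstHom L L L).toRingHom.comp θ) = algebraMap ℝ[X][X] L := by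
      show _ = eval₂RingHom (aeval u : ℝ[X] →ₐ[ℝ] L).toRingHom φ
      apply Polynomial.ringHom_ext
      · intro a; simp [θ]
      · simp [θ]
    exact congrArg (fun f => f s) this
  obtain ⟨ψ, h1, h2⟩ := exists_lift_dual (S := ℝ[X][X]) (L := L)
    ((injective_iff_map_eq_zero _).2 hind) θ hθ
  have hC : ∀ q : ℝ[X], ψ (aeval u q) = TrivSqZeroExt.inl (aeval u q) := by
    intro q
    have := h2 (Polynomial.C q)
    rw [hmap] at this
    simpa [θ] using this
  have hX : ψ φ = TrivSqZeroExt.inl φ + TrivSqZeroExt.inr 1 := by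
    have := h2 Polynomial.X
    rw [hmap] at this
    simpa [θ] using this
  have hR : ∀ r : ℝ, ψ (algebraMap ℝ L r) = TrivSqZeroExt.inl (algebraMap ℝ L r) := by
    intro r; simpa using hC (Polynomial.C r)
  let D0 : L →ₗ[ℝ] L :=
    { toFun := fun x => (ψ x).snd
      map_add' := by intro x y; simp
      map_smul' := by
        intro r x
        rw [Algebra.smul_def, map_mul, hR]
        simp [Algebra.smul_def] }
  refine ⟨Derivation.mk' D0 ?_, ?_, ?_⟩
  · intro a b
    show (ψ (a * b)).snd = a • (ψ b).snd + b • (ψ a).snd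
    rw [map_mul, TrivSqZeroExt.snd_mul, h1, h1]
    simp [mul_comm]
  · show (ψ u).snd = 0
    have := hC Polynomial.X
    rw [Polynomial.aeval_X] at this
    rw [this]; simp
  · show (ψ φ).snd = 1
    rw [hX]; simp


open Polynomial in
lemma exists_vector_field {n : ℕ} (p : Ideal (MvPolynomial (Fin n) ℝ))
    {L : Type} [Field L] [Algebra ℝ L] [Algebra.EssFiniteType ℝ L]
    (ι : MvPolynomial (Fin n) ℝ →ₐ[ℝ] L) (hι : ∀ q, ι q = 0 ↔ q ∈ p)
    (hfrac : ∀ x : L, ∃ r s, s ∉ p ∧ x = ι r / ι s)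
    (U H a b : MvPolynomial (Fin n) ℝ) (hH : H ∉ p) (hb : b ∉ p)
    (hind : ∀ P : ℝ[X][X], Polynomial.eval₂
      (Polynomial.aeval (ι U / ι H) : ℝ[X] →ₐ[ℝ] L).toRingHom (ι a / ι b) P = 0 → P = 0) :
    ∃ w : Fin n → MvPolynomial (Fin n) ℝ,
      (∀ q ∈ p, mkDerivation ℝ w q ∈ p) ∧
      mkDerivation ℝ w U * H - U * mkDerivation ℝ w H ∈ p ∧
      mkDerivation ℝ w a * b - a * mkDerivation ℝ w b ∉ p := by
  obtain ⟨D, hu, hφ⟩ := exists_derivation _ _ hind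
  clear hind
  choose r s hs hrs using fun i : Fin n => hfrac (D (ι (X i)))
  let d : MvPolynomial (Fin n) ℝ := ∏ i, s i
  have hd : ι d ≠ 0 := by
    simp only [d, map_prod]
    exact Finset.prod_ne_zero_iff.2 (fun i _ h => hs i ((hι _).1 h))
  let w : Fin n → MvPolynomial (Fin n) ℝ := fun i => r i * ∏ j ∈ Finset.univ.erase i, s j
  have hw : ∀ i, ι (w i) = ι d * D (ι (X i)) := by
    intro i
    have h1 : ι (s i) ≠ 0 := fun h => hs i ((hι _).1 h)
    rw [hrs i]
    simp only [w, d, map_mul]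
    rw [← Finset.mul_prod_erase Finset.univ s (Finset.mem_univ i), map_mul]
    field_simp
  have key : ∀ q, ι (mkDerivation ℝ w q) = ι d * D (ι q) := by
    intro q
    induction q using MvPolynomial.induction_on with
    | C c =>
      have : ι (C c) = algebraMap ℝ L c := by
        rw [← MvPolynomial.algebraMap_eq]; exact ι.commutes c
      rw [this]; simp
    | add f g hf hg => simp only [map_add, hf, hg]; ring
    | mul_X f i hf =>
      simp only [Derivation.leibniz, map_add, map_mul, smul_eq_mul, hf, MvPolynomial.mkDerivation_X, hw]
      ring
  have hH' : ι H ≠ 0 := fun h => hH ((hι _).1 h)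
  have hb' : ι b ≠ 0 := fun h => hb ((hι _).1 h)
  refine ⟨w, ?_, ?_, ?_⟩
  · intro q hq
    rw [← hι, key, (hι q).2 hq]; simp
  · rw [← hι]
    rw [Derivation.leibniz_div] at hu
    simp only [map_sub, map_mul, key]
    have : ι H * D (ι U) - ι U * D (ι H) = 0 := by
      have h2 := hu
      simp only [smul_eq_mul] at h2
      field_simp at h2
      simpa using h2
    linear_combination ι d * this
  · rw [← hι]
    rw [Derivation.leibniz_div] at hφ
    simp only [map_sub, map_mul, key]
    intro h0
    have h3 : ι b * D (ι a) - ι a * D (ι b) = 0 := by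
      have : ι d * (ι b * D (ι a) - ι a * D (ι b)) = 0 := by linear_combination h0
      exact (mul_eq_zero.1 this).resolve_left hd
    simp only [smul_eq_mul, h3, mul_zero] at hφ
    exact zero_ne_one hφ


lemma hasDerivAt_eval_curve {n : ℕ} (w : Fin n → MvPolynomial (Fin n) ℝ) (x : ℝ → Fin n → ℝ) (t : ℝ)
    (hx : HasDerivAt x (fun i => eval (x t) (w i)) t) (q : MvPolynomial (Fin n) ℝ) :
    HasDerivAt (fun s => eval (x s) q) (eval (x t) (mkDerivation ℝ w q)) t := by
  induction q using MvPolynomial.induction_on with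
  | C c => simpa using hasDerivAt_const t c
  | add f g hf hg => simp only [map_add]; exact hf.add hg
  | mul_X f i hf =>
    have h1 : HasDerivAt (fun s => x s i) (eval (x t) (w i)) t := (hasDerivAt_pi.1 hx) i
    have h2 := hf.mul h1
    simp only [map_mul, eval_X, Derivation.leibniz, map_add, smul_eq_mul, mkDerivation_X]
    refine h2.congr_deriv ?_
    ring

lemma exists_flow {n : ℕ} (p : Ideal (MvPolynomial (Fin n) ℝ)) (w : Fin n → MvPolynomial (Fin n) ℝ)
    (hp : ∀ q ∈ p, mkDerivation ℝ w q ∈ p) (v : Fin n → ℝ) (hv : ∀ q ∈ p, eval v q = 0) :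
    ∃ (x : ℝ → Fin n → ℝ) (ε : ℝ), 0 < ε ∧ x 0 = v ∧
      (∀ t ∈ Icc 0 ε, ∀ q, HasDerivAt (fun s => eval (x s) q) (eval (x t) (mkDerivation ℝ w q)) t) ∧
      (∀ t ∈ Icc 0 ε, ContinuousAt x t) ∧
      ∀ t ∈ Icc 0 ε, ∀ q ∈ p, eval (x t) q = 0 := by
  have hsm : ContDiffAt ℝ 1 (fun y : Fin n → ℝ => fun i => eval y (w i)) v := by
    rw [contDiffAt_pi]
    intro i
    exact (AnalyticOnNhd.eval_mvPolynomial (w i) v (mem_univ _)).contDiffAt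
  obtain ⟨x, hx0, ε, hε, hx⟩ :=
    hsm.exists_forall_mem_closedBall_exists_eq_forall_mem_Ioo_hasDerivAt₀ 0
  have hsub : ∀ t ∈ Icc 0 (ε / 2), t ∈ Ioo (0 - ε) (0 + ε) := by
    intro t ht; constructor <;> linarith [ht.1, ht.2]
  have hder : ∀ t ∈ Icc 0 (ε / 2), ∀ q,
      HasDerivAt (fun s => eval (x s) q) (eval (x t) (mkDerivation ℝ w q)) t :=
    fun t ht q => hasDerivAt_eval_curve w x t (hx t (hsub t ht)) q
  refine ⟨x, ε / 2, half_pos hε, hx0, hder, fun t ht => (hx t (hsub t ht)).continuousAt, ?_⟩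
  obtain ⟨m, g, hg⟩ := Submodule.fg_iff_exists_fin_generating_family.1
    (IsNoetherian.noetherian p)
  have hgp : ∀ i, g i ∈ p := fun i => hg ▸ Submodule.subset_span (mem_range_self i)
  have hA : ∀ i, ∃ A : Fin m → MvPolynomial (Fin n) ℝ, ∑ j, A j * g j = mkDerivation ℝ w (g i) := by
    intro i
    have h := hp _ (hgp i)
    rw [← hg] at h
    exact Ideal.mem_span_range_iff_exists_fun.1 h
  choose A hA using hA
  have hcont : ContinuousOn (fun t => ∑ i, ∑ j, |eval (x t) (A i j)|) (Icc 0 (ε / 2)) := by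
    refine continuousOn_finsetSum _ fun i _ => continuousOn_finsetSum _ fun j _ => ?_
    exact fun t ht => ((hder t ht (A i j)).continuousAt.abs).continuousWithinAt
  obtain ⟨K, hK⟩ := isCompact_Icc.exists_bound_of_continuousOn hcont
  have hzero := eq_zero_of_abs_deriv_le_mul_abs_self_of_eq_zero_right
    (f := fun t => fun i : Fin m => eval (x t) (g i))
    (f' := fun t => fun i : Fin m => eval (x t) (mkDerivation ℝ w (g i))) (K := K) (a := 0) (b := ε / 2)
    (by
      refine continuousOn_pi.2 fun i => ?_
      exact fun t ht => (hder t ht (g i)).continuousAt.continuousWithinAt)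
    (by
      intro t ht
      refine hasDerivWithinAt_pi.2 fun i => ?_
      exact (hder t (Ico_subset_Icc_self ht) (g i)).hasDerivWithinAt)
    (by funext i; simp [hx0, hv _ (hgp i)])
    (by
      intro t ht
      have hKt := hK t (Ico_subset_Icc_self ht)
      have hK0 : 0 ≤ K := (norm_nonneg _).trans hKt
      refine (pi_norm_le_iff_of_nonneg (by positivity)).2 fun i => ?_
      rw [← hA i, map_sum]
      refine (norm_sum_le _ _).trans ?_
      calc ∑ j, ‖eval (x t) (A i j * g j)‖
          ≤ ∑ j, |eval (x t) (A i j)| * ‖fun i : Fin m => eval (x t) (g i)‖ := by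
            refine Finset.sum_le_sum fun j _ => ?_
            rw [map_mul, norm_mul]
            exact mul_le_mul_of_nonneg_left
              (norm_le_pi_norm (fun i : Fin m => eval (x t) (g i)) j) (norm_nonneg _)
        _ = (∑ j, |eval (x t) (A i j)|) * ‖fun i : Fin m => eval (x t) (g i)‖ := by
            rw [Finset.sum_mul]
        _ ≤ K * ‖fun i : Fin m => eval (x t) (g i)‖ := by
            refine mul_le_mul_of_nonneg_right ?_ (norm_nonneg _)
            refine le_trans ?_ ((le_abs_self _).trans hKt)
            exact Finset.single_le_sum (f := fun i => ∑ j, |eval (x t) (A i j)|)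
              (fun i _ => Finset.sum_nonneg fun j _ => abs_nonneg _) (Finset.mem_univ i))
  intro t ht q hq
  rw [← hg] at hq
  obtain ⟨c, rfl⟩ := Ideal.mem_span_range_iff_exists_fun.1 hq
  rw [map_sum]
  refine Finset.sum_eq_zero fun j _ => ?_
  have := congrFun (hzero t ht) j
  rw [map_mul]
  simp only [Pi.zero_apply] at this
  rw [this, mul_zero]


lemma descent_neg {n : ℕ} (p : Ideal (MvPolynomial (Fin n) ℝ)) (w : Fin n → MvPolynomial (Fin n) ℝ)
    (U H a b : MvPolynomial (Fin n) ℝ)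
    (hp : ∀ q ∈ p, mkDerivation ℝ w q ∈ p)
    (hU : mkDerivation ℝ w U * H - U * mkDerivation ℝ w H ∈ p)
    (v : Fin n → ℝ) (hv : ∀ q ∈ p, eval v q = 0) (hH : eval v H ≠ 0) (hb : eval v b ≠ 0)
    (hneg : eval v (mkDerivation ℝ w a * b - a * mkDerivation ℝ w b) < 0)
    (O : Set (Fin n → ℝ)) (hO : O ∈ nhds v) :
    ∃ y ∈ O, (∀ q ∈ p, eval y q = 0) ∧ eval y H ≠ 0 ∧ eval y b ≠ 0 ∧
      eval y U / eval y H = eval v U / eval v H ∧ eval y a / eval y b < eval v a / eval v b := by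
  obtain ⟨x, ε, hε, hx0, hder, hcx, hxp⟩ := exists_flow p w hp v hv
  have h0 : (0 : ℝ) ∈ Icc 0 ε := ⟨le_rfl, hε.le⟩
  have e1 : ∀ᶠ t in nhds (0 : ℝ), x t ∈ O := (hcx 0 h0) (by rw [hx0]; exact hO)
  have e2 : ∀ᶠ t in nhds (0 : ℝ), eval (x t) H ≠ 0 :=
    (hder 0 h0 H).continuousAt.eventually_ne (by rwa [hx0])
  have e3 : ∀ᶠ t in nhds (0 : ℝ), eval (x t) b ≠ 0 :=
    (hder 0 h0 b).continuousAt.eventually_ne (by rwa [hx0])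
  obtain ⟨δ, hδ, hball⟩ := Metric.eventually_nhds_iff.1 (e1.and (e2.and e3))
  have hφ : HasDerivAt (fun t => eval (x t) a / eval (x t) b)
      ((eval v (mkDerivation ℝ w a) * eval v b - eval v a * eval v (mkDerivation ℝ w b)) / (eval v b) ^ 2) 0 := by
    have := (hder 0 h0 a).div (hder 0 h0 b) (by rwa [hx0])
    rw [hx0] at this
    exact this
  have hm : (eval v (mkDerivation ℝ w a) * eval v b - eval v a * eval v (mkDerivation ℝ w b)) / (eval v b) ^ 2 < 0 := by
    apply div_neg_of_neg_of_pos
    · simpa using hneg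
    · positivity
  have e4 : ∀ᶠ t in nhdsWithin (0 : ℝ) (Ioi 0), eval (x t) a / eval (x t) b < eval v a / eval v b := by
    have := hφ.tendsto_slope_zero_right.eventually (gt_mem_nhds hm)
    filter_upwards [this, self_mem_nhdsWithin] with t ht ht0
    simp only [zero_add, smul_eq_mul, hx0] at ht
    have ht0' : (0 : ℝ) < t := ht0
    by_contra hcon
    have : 0 ≤ t⁻¹ * (eval (x t) a / eval (x t) b - eval v a / eval v b) :=
      mul_nonneg (inv_nonneg.2 ht0'.le) (by linarith)
    linarith
  have e5 : ∀ᶠ t in nhdsWithin (0 : ℝ) (Ioi 0), t ∈ Ioo 0 (min δ ε) :=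
    Ioo_mem_nhdsGT (lt_min hδ hε)
  obtain ⟨t, ht4, ht5⟩ := (e4.and e5).exists
  have htδ : t < δ := ht5.2.trans_le (min_le_left _ _)
  have htε : t < ε := ht5.2.trans_le (min_le_right _ _)
  have hin : ∀ s ∈ Icc 0 t, x s ∈ O ∧ eval (x s) H ≠ 0 ∧ eval (x s) b ≠ 0 := by
    intro s hs
    apply hball
    rw [Real.dist_eq, sub_zero, abs_of_nonneg hs.1]
    exact hs.2.trans_lt htδ
  have hε' : ∀ s ∈ Icc 0 t, s ∈ Icc 0 ε := fun s hs => ⟨hs.1, hs.2.trans htε.le⟩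
  have hu : ∀ s ∈ Icc 0 t, HasDerivAt (fun t => eval (x t) U / eval (x t) H) 0 s := by
    intro s hs
    have h1 := (hder s (hε' s hs) U).div (hder s (hε' s hs) H) (hin s hs).2.1
    have h2 := hxp s (hε' s hs) _ hU
    refine h1.congr_deriv ?_
    rw [map_sub, map_mul, map_mul] at h2
    rw [h2, zero_div]
  have hconst := constant_of_has_deriv_right_zero (f := fun t => eval (x t) U / eval (x t) H)
    (a := 0) (b := t) (fun s hs => (hu s hs).continuousAt.continuousWithinAt)
    (fun s hs => (hu s (Ico_subset_Icc_self hs)).hasDerivWithinAt) t ⟨ht5.1.le, le_rfl⟩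
  have htt : t ∈ Icc 0 t := ⟨ht5.1.le, le_rfl⟩
  refine ⟨x t, (hin t htt).1, hxp t (hε' t htt), (hin t htt).2.1, (hin t htt).2.2, ?_, ht4⟩
  simpa [hx0] using hconst

lemma descent {n : ℕ} (p : Ideal (MvPolynomial (Fin n) ℝ)) (w : Fin n → MvPolynomial (Fin n) ℝ)
    (U H a b : MvPolynomial (Fin n) ℝ)
    (hp : ∀ q ∈ p, mkDerivation ℝ w q ∈ p)
    (hU : mkDerivation ℝ w U * H - U * mkDerivation ℝ w H ∈ p)
    (v : Fin n → ℝ) (hv : ∀ q ∈ p, eval v q = 0) (hH : eval v H ≠ 0) (hb : eval v b ≠ 0)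
    (hne : eval v (mkDerivation ℝ w a * b - a * mkDerivation ℝ w b) ≠ 0)
    (O : Set (Fin n → ℝ)) (hO : O ∈ nhds v) :
    ∃ y ∈ O, (∀ q ∈ p, eval y q = 0) ∧ eval y H ≠ 0 ∧ eval y b ≠ 0 ∧
      eval y U / eval y H = eval v U / eval v H ∧ eval y a / eval y b < eval v a / eval v b := by
  rcases lt_or_gt_of_ne hne with h | h
  · exact descent_neg p w U H a b hp hU v hv hH hb h O hO
  · have hw : mkDerivation ℝ (-w) = - mkDerivation ℝ w := by
      apply MvPolynomial.derivation_ext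
      intro i
      simp
    refine descent_neg p (-w) U H a b ?_ ?_ v hv hH hb ?_ O hO
    · intro q hq
      rw [hw]
      exact p.neg_mem (hp q hq)
    · have := p.neg_mem hU
      rw [hw]
      convert this using 1
      simp only [Derivation.neg_apply]
      ring
    · rw [hw]
      simp only [Derivation.neg_apply, map_sub, map_mul, map_neg] at h ⊢
      linarith


open Polynomial in
lemma poly_bound (c : ℝ[X]) : ∃ (C : ℝ) (N : ℕ), 0 ≤ C ∧ ∀ u : ℝ, 1 ≤ u → |c.eval u| ≤ C * u ^ N := by
  induction c using Polynomial.induction_on' with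
  | add p q hp hq =>
    obtain ⟨C1, N1, h1, hp⟩ := hp
    obtain ⟨C2, N2, h2, hq⟩ := hq
    refine ⟨C1 + C2, max N1 N2, by positivity, fun u hu => ?_⟩
    rw [Polynomial.eval_add]
    refine (abs_add_le _ _).trans ?_
    have e1 : u ^ N1 ≤ u ^ (max N1 N2) := pow_le_pow_right₀ hu (le_max_left _ _)
    have e2 : u ^ N2 ≤ u ^ (max N1 N2) := pow_le_pow_right₀ hu (le_max_right _ _)
    nlinarith [hp u hu, hq u hu, mul_le_mul_of_nonneg_left e1 h1, mul_le_mul_of_nonneg_left e2 h2]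
  | monomial k a =>
    refine ⟨|a|, k, abs_nonneg _, fun u hu => ?_⟩
    rw [Polynomial.eval_monomial, abs_mul, abs_pow, abs_of_nonneg (by linarith : (0:ℝ) ≤ u)]

open Polynomial in
lemma poly_bound2 (R : ℝ[X][X]) : ∃ (C : ℝ) (N : ℕ), 0 ≤ C ∧ ∀ u φ : ℝ, 1 ≤ u → 0 ≤ φ → φ ≤ 1 →
    |R.eval₂ (Polynomial.evalRingHom u) φ| ≤ C * u ^ N := by
  induction R using Polynomial.induction_on' with
  | add p q hp hq =>
    obtain ⟨C1, N1, h1, hp⟩ := hp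
    obtain ⟨C2, N2, h2, hq⟩ := hq
    refine ⟨C1 + C2, max N1 N2, by positivity, fun u φ hu h0 hl => ?_⟩
    rw [Polynomial.eval₂_add]
    refine (abs_add_le _ _).trans ?_
    have e1 : u ^ N1 ≤ u ^ (max N1 N2) := pow_le_pow_right₀ hu (le_max_left _ _)
    have e2 : u ^ N2 ≤ u ^ (max N1 N2) := pow_le_pow_right₀ hu (le_max_right _ _)
    nlinarith [hp u φ hu h0 hl, hq u φ hu h0 hl, mul_le_mul_of_nonneg_left e1 h1,
      mul_le_mul_of_nonneg_left e2 h2]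
  | monomial k a =>
    obtain ⟨C, N, hC, h⟩ := poly_bound a
    refine ⟨C, N, hC, fun u φ hu h0 hl => ?_⟩
    rw [Polynomial.eval₂_monomial, abs_mul, abs_pow, abs_of_nonneg h0]
    have : φ ^ k ≤ 1 := pow_le_one₀ h0 hl
    have h' := h u hu
    calc |(Polynomial.evalRingHom u) a| * φ ^ k ≤ |(Polynomial.evalRingHom u) a| * 1 :=
          mul_le_mul_of_nonneg_left this (abs_nonneg _)
      _ ≤ C * u ^ N := by simpa using h'

open Polynomial in
lemma poly_lower (c : ℝ[X]) (hc : c ≠ 0) : ∃ ε > (0 : ℝ), ∀ᶠ u in Filter.atTop, ε ≤ |c.eval u| := by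
  by_cases hd : 0 < c.degree
  · exact ⟨1, one_pos, (Polynomial.abs_tendsto_atTop c hd).eventually_ge_atTop 1⟩
  · rw [not_lt] at hd
    rw [Polynomial.eq_C_of_degree_le_zero hd] at hc ⊢
    refine ⟨|c.coeff 0|, ?_, ?_⟩
    · simpa using hc
    · simp

open Polynomial in
lemma growth (l : Filter ℕ) (hl : l ≤ Filter.atTop) (u φ : ℕ → ℝ) (hu : Filter.Tendsto u l Filter.atTop)
    (hφ : ∀ᶠ j in l, 0 < φ j) (hb : ∀ᶠ j in l, φ j * u j ^ j ≤ 1) (P : ℝ[X][X]) (hP : P ≠ 0) :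
    ∀ᶠ j in l, P.eval₂ (Polynomial.evalRingHom (u j)) (φ j) ≠ 0 := by
  obtain ⟨Q, hPQ, hQ⟩ := Polynomial.exists_eq_pow_rootMultiplicity_mul_and_not_dvd P hP 0
  rw [Polynomial.C_0, sub_zero] at hPQ hQ
  rw [Polynomial.X_dvd_iff] at hQ
  obtain ⟨ε, hε, hlow⟩ := poly_lower _ hQ
  obtain ⟨C, N, hC, hR⟩ := poly_bound2 Q.divX
  have e1 := hu.eventually hlow
  have e2 : ∀ᶠ j in l, C / ε + 1 ≤ u j := hu.eventually_ge_atTop _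
  have e3 : ∀ᶠ j in l, N + 1 ≤ j := hl (Filter.eventually_ge_atTop _)
  filter_upwards [e1, e2, e3, hφ, hb] with j h1 h2 h3 h4 h5
  rw [hPQ, Polynomial.eval₂_mul, Polynomial.eval₂_pow, Polynomial.eval₂_X]
  refine mul_ne_zero (pow_ne_zero _ h4.ne') ?_
  have hu1 : 1 ≤ u j := le_trans (by have := div_nonneg hC hε.le; linarith) h2
  have hu0 : 0 < u j := by linarith
  have hφ1 : φ j ≤ 1 := by
    have : 1 ≤ u j ^ j := one_le_pow₀ hu1
    nlinarith
  have hφN : φ j * u j ^ N * u j ≤ 1 := by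
    have : u j ^ (N + 1) ≤ u j ^ j := pow_le_pow_right₀ hu1 h3
    calc φ j * u j ^ N * u j = φ j * u j ^ (N + 1) := by ring
      _ ≤ φ j * u j ^ j := mul_le_mul_of_nonneg_left this h4.le
      _ ≤ 1 := h5
  have hRj := hR (u j) (φ j) hu1 h4.le hφ1
  have hdecomp : Q.eval₂ (Polynomial.evalRingHom (u j)) (φ j) =
      Q.divX.eval₂ (Polynomial.evalRingHom (u j)) (φ j) * φ j + (Q.coeff 0).eval (u j) := by
    conv_lhs => rw [← Polynomial.divX_mul_X_add Q]
    simp [Polynomial.eval₂_add, Polynomial.eval₂_mul]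
  rw [hdecomp]
  intro h0
  have habs : |(Q.coeff 0).eval (u j)| ≤ C * u j ^ N * φ j := by
    have : (Q.coeff 0).eval (u j) = -(Q.divX.eval₂ (Polynomial.evalRingHom (u j)) (φ j) * φ j) := by
      linarith
    rw [this, abs_neg, abs_mul, abs_of_pos h4]
    exact mul_le_mul_of_nonneg_right hRj h4.le
  have h6 : ε * u j ≤ C := by
    have : ε ≤ C * u j ^ N * φ j := h1.trans habs
    calc ε * u j ≤ C * u j ^ N * φ j * u j := mul_le_mul_of_nonneg_right this hu0.le
      _ = C * (φ j * u j ^ N * u j) := by ring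
      _ ≤ C * 1 := mul_le_mul_of_nonneg_left hφN hC
      _ = C := mul_one C
  have h7 : u j ≤ C / ε := by rw [le_div_iff₀ hε]; linarith
  linarith

open Polynomial in
lemma ultra {n : ℕ} (l : Ultrafilter ℕ) (hl : (l : Filter ℕ) ≤ Filter.atTop) (v : ℕ → Fin n → ℝ)
    (U H a b : MvPolynomial (Fin n) ℝ)
    (hH : ∀ᶠ j in (l : Filter ℕ), eval (v j) H ≠ 0) (hb : ∀ᶠ j in (l : Filter ℕ), eval (v j) b ≠ 0)
    (hu : Filter.Tendsto (fun j => eval (v j) U / eval (v j) H) l Filter.atTop)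
    (hφ : ∀ᶠ j in (l : Filter ℕ), 0 < eval (v j) a / eval (v j) b)
    (hbd : ∀ᶠ j in (l : Filter ℕ), eval (v j) a / eval (v j) b * (eval (v j) U / eval (v j) H) ^ j ≤ 1) :
    ∃ p : Ideal (MvPolynomial (Fin n) ℝ), (∀ q, q ∈ p ↔ ∀ᶠ j in (l : Filter ℕ), eval (v j) q = 0) ∧
    ∃ w : Fin n → MvPolynomial (Fin n) ℝ,
      (∀ q ∈ p, mkDerivation ℝ w q ∈ p) ∧
      mkDerivation ℝ w U * H - U * mkDerivation ℝ w H ∈ p ∧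
      mkDerivation ℝ w a * b - a * mkDerivation ℝ w b ∉ p := by
  let G := Filter.Germ (l : Filter ℕ) ℝ
  let Ψ : (ℕ → ℝ) →+* G := Filter.Germ.coeRingHom (l : Filter ℕ)
  have hΨ : ∀ f g : ℕ → ℝ, Ψ f = Ψ g ↔ f =ᶠ[l] g := fun f g => Filter.Germ.coe_eq
  let ev : MvPolynomial (Fin n) ℝ →+* G := Ψ.comp (RingHom.pi fun j => eval (v j))
  have hev : ∀ q, ev q = Ψ (fun j => eval (v j) q) := fun q => rfl
  let p := RingHom.ker ev
  have hp : ∀ q, q ∈ p ↔ ∀ᶠ j in (l : Filter ℕ), eval (v j) q = 0 := by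
    intro q
    rw [RingHom.mem_ker, hev, ← map_zero Ψ, hΨ]
    rfl
  have hprime : p.IsPrime := RingHom.ker_isPrime ev
  refine ⟨p, hp, ?_⟩
  let L := FractionRing (MvPolynomial (Fin n) ℝ ⧸ p)
  have i1 : Algebra.EssFiniteType (MvPolynomial (Fin n) ℝ ⧸ p) L :=
    .of_isLocalization _ (nonZeroDivisors _)
  have i2 : Algebra.EssFiniteType ℝ L := .comp ℝ (MvPolynomial (Fin n) ℝ ⧸ p) _
  let ι : MvPolynomial (Fin n) ℝ →ₐ[ℝ] L :=
    (IsScalarTower.toAlgHom ℝ (MvPolynomial (Fin n) ℝ ⧸ p) L).comp (Ideal.Quotient.mkₐ ℝ p)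
  have hι : ∀ q, ι q = 0 ↔ q ∈ p := by
    intro q
    show algebraMap _ L (Ideal.Quotient.mk p q) = 0 ↔ _
    rw [FaithfulSMul.algebraMap_eq_zero_iff, Ideal.Quotient.eq_zero_iff_mem]
  have hfrac : ∀ x : L, ∃ r s, s ∉ p ∧ x = ι r / ι s := by
    intro x
    obtain ⟨r, s, hs, rfl⟩ := IsFractionRing.div_surjective (A := MvPolynomial (Fin n) ℝ ⧸ p) x
    obtain ⟨r, rfl⟩ := Ideal.Quotient.mk_surjective r
    obtain ⟨s, rfl⟩ := Ideal.Quotient.mk_surjective s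
    refine ⟨r, s, ?_, rfl⟩
    intro h
    rw [← Ideal.Quotient.eq_zero_iff_mem] at h
    exact nonZeroDivisors.ne_zero hs h
  let τ : L →+* G := IsFractionRing.lift (A := MvPolynomial (Fin n) ℝ ⧸ p) (g := RingHom.kerLift ev)
    (RingHom.kerLift_injective ev)
  have hτ : ∀ q, τ (ι q) = ev q := by
    intro q
    show IsFractionRing.lift _ (algebraMap _ L (Ideal.Quotient.mk p q)) = _
    rw [IsFractionRing.lift_algebraMap]
    rfl
  have hdiv : ∀ q r, τ (ι q / ι r) = Ψ (fun j => eval (v j) q / eval (v j) r) := by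
    intro q r
    rw [map_div₀, hτ, hτ]
    rfl
  have hHp : H ∉ p := by
    rw [hp]
    intro h
    obtain ⟨j, h1, h2⟩ := (h.and hH).exists
    exact h2 h1
  have hbp : b ∉ p := by
    rw [hp]
    intro h
    obtain ⟨j, h1, h2⟩ := (h.and hb).exists
    exact h2 h1
  refine exists_vector_field p ι hι hfrac U H a b hHp hbp ?_
  intro P hP0
  by_contra hP
  have hg := growth l hl _ _ hu hφ hbd P hP
  have h1 := congrArg τ hP0
  rw [Polynomial.hom_eval₂, map_zero, hdiv] at h1
  have hcomp : τ.comp (Polynomial.aeval (ι U / ι H) : ℝ[X] →ₐ[ℝ] L).toRingHom =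
      Ψ.comp (RingHom.pi fun j => Polynomial.evalRingHom (eval (v j) U / eval (v j) H)) := by
    apply Polynomial.ringHom_ext
    · intro r
      have e1 : (Polynomial.aeval (ι U / ι H) : ℝ[X] →ₐ[ℝ] L).toRingHom (Polynomial.C r) = ι (MvPolynomial.C r) := by
        show Polynomial.aeval (ι U / ι H) (Polynomial.C r) = _
        rw [Polynomial.aeval_C, ← MvPolynomial.algebraMap_eq]
        exact (ι.commutes r).symm
      rw [RingHom.comp_apply, e1, hτ, hev, RingHom.comp_apply]
      congr 1
      funext j
      show MvPolynomial.eval (v j) (MvPolynomial.C r) = Polynomial.eval _ (Polynomial.C r)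
      rw [Polynomial.eval_C, MvPolynomial.eval_C]
    · rw [RingHom.comp_apply, RingHom.comp_apply]
      have e1 : (Polynomial.aeval (ι U / ι H) : ℝ[X] →ₐ[ℝ] L).toRingHom Polynomial.X = ι U / ι H :=
        Polynomial.aeval_X _
      rw [e1, hdiv]
      congr 1
      funext j
      show _ = Polynomial.eval _ Polynomial.X
      rw [Polynomial.eval_X]
  rw [hcomp, ← Polynomial.hom_eval₂, ← map_zero Ψ, hΨ] at h1
  obtain ⟨j, h2, h3⟩ := (h1.and hg).exists
  apply h3
  have h4 : Pi.evalRingHom (fun _ : ℕ => ℝ) j (Polynomial.eval₂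
    (RingHom.pi fun j => Polynomial.evalRingHom (eval (v j) U / eval (v j) H))
      (fun j => eval (v j) a / eval (v j) b) P) = 0 := h2
  rw [Polynomial.hom_eval₂] at h4
  exact h4


lemma loj_compact {n : ℕ} (J : Set (MvPolynomial (Fin n) ℝ)) (H c U : MvPolynomial (Fin n) ℝ)
    (hH : ∀ x, 0 ≤ eval x H) (hU : ∀ x, eval x U = (1 + ∑ i, x i ^ 2) * eval x H + 1)
    (C : Set (Fin n → ℝ)) (hC : IsClosed C) (ρ : ℝ) :
    IsCompact {x | x ∈ C ∧ (∀ q ∈ J, eval x q = 0) ∧ 0 ≤ eval x c ∧ eval x U ≤ ρ * eval x H} := by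
  have hcl : IsClosed {x | x ∈ C ∧ (∀ q ∈ J, eval x q = 0) ∧ 0 ≤ eval x c ∧ eval x U ≤ ρ * eval x H} := by
    have e1 : IsClosed {x : Fin n → ℝ | ∀ q ∈ J, eval x q = 0} := by
      simp only [Set.ofPred_forall]
      exact isClosed_iInter fun q => isClosed_iInter fun _ =>
        isClosed_eq (MvPolynomial.continuous_eval q) continuous_const
    have e2 : IsClosed {x : Fin n → ℝ | 0 ≤ eval x c} :=
      isClosed_le continuous_const (MvPolynomial.continuous_eval c)
    have e3 : IsClosed {x : Fin n → ℝ | eval x U ≤ ρ * eval x H} :=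
      isClosed_le (MvPolynomial.continuous_eval U) (continuous_const.mul (MvPolynomial.continuous_eval H))
    exact hC.inter (e1.inter (e2.inter e3))
  refine (isCompact_Icc (a := fun _ : Fin n => -(ρ + 1)) (b := fun _ => ρ + 1)).of_isClosed_subset hcl ?_
  rintro x ⟨-, -, -, h⟩
  rw [hU] at h
  have hH0 : 0 < eval x H := by
    rcases (hH x).lt_or_eq with h' | h'
    · exact h'
    · rw [← h'] at h; norm_num at h
  have hs : 1 + ∑ i, x i ^ 2 ≤ ρ := by
    by_contra hcon
    nlinarith
  have hi : ∀ i, x i ^ 2 ≤ ∑ i, x i ^ 2 := fun i =>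
    Finset.single_le_sum (f := fun i => x i ^ 2) (fun i _ => sq_nonneg _) (Finset.mem_univ i)
  constructor
  · intro i
    show -(ρ + 1) ≤ x i
    nlinarith [hi i, sq_nonneg (x i)]
  · intro i
    show x i ≤ ρ + 1
    nlinarith [hi i, sq_nonneg (x i)]

lemma lojasiewicz {n : ℕ} (J : Set (MvPolynomial (Fin n) ℝ)) (H c : MvPolynomial (Fin n) ℝ)
    (hH : ∀ x, 0 ≤ eval x H) (O C : Set (Fin n → ℝ)) (hO : IsOpen O) (hC : IsClosed C)
    (hOC : ∀ x, (∀ q ∈ J, eval x q = 0) → eval x H ≠ 0 → (x ∈ O ↔ x ∈ C))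
    (F : (Fin n → ℝ) → ℝ) (hF : Continuous F)
    (hpos : ∀ x ∈ C, (∀ q ∈ J, eval x q = 0) → eval x H ≠ 0 → 0 ≤ eval x c → 0 < F x)
    (K : ℕ) (a b : ℕ → MvPolynomial (Fin n) ℝ)
    (hK : ∀ x, (∀ q ∈ J, eval x q = 0) → eval x H ≠ 0 → ∃ k ≤ K, eval x (b k) ≠ 0)
    (hab : ∀ x, (∀ q ∈ J, eval x q = 0) → eval x H ≠ 0 → ∀ k ≤ K, (∀ i < k, eval x (b i) = 0) →
      eval x (b k) ≠ 0 → F x = eval x (a k) / eval x (b k)) :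
    ∃ (G : MvPolynomial (Fin n) ℝ) (N : ℕ), (∀ x, 0 ≤ eval x G) ∧
      ∀ x ∈ C, (∀ q ∈ J, eval x q = 0) → eval x H ≠ 0 → 0 ≤ eval x c →
        eval x H ^ N ≤ eval x G * F x := by
  set U : MvPolynomial (Fin n) ℝ := (1 + ∑ i, X i ^ 2) * H + 1 with hUdef
  have hU : ∀ x, eval x U = (1 + ∑ i, x i ^ 2) * eval x H + 1 := by
    intro x; simp [hUdef]
  have hU1 : ∀ x, 1 ≤ eval x U := by
    intro x
    rw [hU]
    have : 0 ≤ ∑ i, x i ^ 2 := Finset.sum_nonneg fun i _ => sq_nonneg _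
    nlinarith [hH x, mul_nonneg this (hH x)]
  have hcomp := loj_compact J H c U hH hU C hC
  set T : Set (Fin n → ℝ) := {x | x ∈ C ∧ (∀ q ∈ J, eval x q = 0) ∧ eval x H ≠ 0 ∧ 0 ≤ eval x c} with hT
  have hHp : ∀ x, eval x H ≠ 0 → 0 < eval x H := fun x hx => lt_of_le_of_ne (hH x) hx.symm
  have hTK : ∀ ρ x, (x ∈ C ∧ (∀ q ∈ J, eval x q = 0) ∧ 0 ≤ eval x c ∧ eval x U ≤ ρ * eval x H) ↔
      x ∈ T ∧ eval x U / eval x H ≤ ρ := by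
    intro ρ x
    constructor
    · rintro ⟨h1, h2, h3, h4⟩
      have h5 : eval x H ≠ 0 := by
        intro h; rw [h, mul_zero] at h4; linarith [hU1 x]
      exact ⟨⟨h1, h2, h5, h3⟩, (div_le_iff₀ (hHp x h5)).2 h4⟩
    · rintro ⟨⟨h1, h2, h5, h3⟩, h4⟩
      exact ⟨h1, h2, h3, (div_le_iff₀ (hHp x h5)).1 h4⟩
  have hmin : ∀ y ∈ T, ∀ ρ, eval y U / eval y H ≤ ρ → ∃ v ∈ T, eval v U / eval v H ≤ ρ ∧
      ∀ x ∈ T, eval x U / eval x H ≤ ρ → F v ≤ F x := by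
    intro y hy ρ hρ
    obtain ⟨v, hv, hvm⟩ := (hcomp ρ).exists_isMinOn ⟨y, (hTK ρ y).2 ⟨hy, hρ⟩⟩ hF.continuousOn
    obtain ⟨hv1, hv2⟩ := (hTK ρ v).1 hv
    exact ⟨v, hv1, hv2, fun x hx hxρ => hvm ((hTK ρ x).2 ⟨hx, hxρ⟩)⟩
  have hFT : ∀ x ∈ T, 0 < F x := fun x ⟨h1, h2, h3, h4⟩ => hpos x h1 h2 h3 h4
  have hu1 : ∀ x ∈ T, 0 < eval x U / eval x H := fun x hx =>
    div_pos (by linarith [hU1 x]) (hHp x hx.2.2.1)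
  have hu2 : ∀ x ∈ T, 1 ≤ eval x U / eval x H := by
    intro x hx
    rw [one_le_div (hHp x hx.2.2.1), hU]
    have : 0 ≤ ∑ i, x i ^ 2 := Finset.sum_nonneg fun i _ => sq_nonneg _
    nlinarith [hH x, mul_nonneg this (hH x)]
  by_contra hcon
  push Not at hcon
  have hv : ∀ j : ℕ, ∃ v ∈ T, (j + 1) * (eval v U / eval v H) ^ j * F v < 1 ∧
      ∀ x ∈ T, eval x U / eval x H ≤ eval v U / eval v H → F v ≤ F x := by
    intro j
    obtain ⟨y, hyC, hyJ, hyH, hyc, hy⟩ := hcon (MvPolynomial.C ((j : ℝ) + 1) * U ^ j) j (by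
      intro x
      have := hU1 x
      rw [map_mul, map_pow, eval_C]
      positivity)
    have hyT : y ∈ T := ⟨hyC, hyJ, hyH, hyc⟩
    obtain ⟨v, hvT, hvρ, hvm⟩ := hmin y hyT _ le_rfl
    refine ⟨v, hvT, ?_, fun x hx hxv => hvm x hx (hxv.trans hvρ)⟩
    rw [map_mul, map_pow, eval_C] at hy
    have hHy := hHp y hyH
    have e1 : (j + 1) * (eval y U / eval y H) ^ j * F y < 1 := by
      rw [div_pow]
      have : (0:ℝ) < eval y H ^ j := by positivity
      rw [show ((j:ℝ) + 1) * (eval y U ^ j / eval y H ^ j) * F y =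
        ((j + 1) * eval y U ^ j * F y) / eval y H ^ j by ring, div_lt_one this]
      exact hy
    refine lt_of_le_of_lt ?_ e1
    have := hFT v hvT
    have := hFT y hyT
    have h3 := hu1 v hvT
    have := hu1 y hyT
    have h2 := hvm y hyT le_rfl
    gcongr
  choose v hvT hvlt hvmin using hv
  have htend : Filter.Tendsto (fun j => eval (v j) U / eval (v j) H) Filter.atTop Filter.atTop := by
    rw [Filter.tendsto_atTop]
    intro R
    by_cases hne : ∃ y ∈ T, eval y U / eval y H ≤ max R 1
    · obtain ⟨y, hy, hyR⟩ := hne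
      obtain ⟨m, hmT, hmR, hmm⟩ := hmin y hy _ hyR
      have hm := hFT m hmT
      obtain ⟨N, hN⟩ := exists_nat_gt (1 / F m)
      filter_upwards [Filter.eventually_ge_atTop N] with j hj
      by_contra hlt
      push Not at hlt
      have h1 := hmm (v j) (hvT j) (hlt.le.trans (le_max_left _ _))
      have hu := hu2 (v j) (hvT j)
      have h2 : (1 : ℝ) ≤ (eval (v j) U / eval (v j) H) ^ j := one_le_pow₀ hu
      have h3 := hvlt j
      have h4 : 1 < ((j : ℝ) + 1) * F m := by
        have : (N : ℝ) ≤ j := by exact_mod_cast hj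
        rw [div_lt_iff₀ hm] at hN
        nlinarith
      have h5 : ((j : ℝ) + 1) * F m ≤ (j + 1) * (eval (v j) U / eval (v j) H) ^ j * F (v j) := by
        have h6 : ((j : ℝ) + 1) * 1 ≤ (j + 1) * (eval (v j) U / eval (v j) H) ^ j := by gcongr
        rw [mul_one] at h6
        gcongr
      linarith
    · push Not at hne
      exact Filter.Eventually.of_forall fun j => (le_max_left R 1).trans (hne _ (hvT j)).le
  let l : Ultrafilter ℕ := Filter.hyperfilter ℕ
  have hl : (l : Filter ℕ) ≤ Filter.atTop := Nat.hyperfilter_le_atTop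
  have hfirst : ∀ j, ∃ k ∈ Set.Iic K, (∀ i < k, eval (v j) (b i) = 0) ∧ eval (v j) (b k) ≠ 0 := by
    intro j
    classical
    have hex : ∃ k, eval (v j) (b k) ≠ 0 := by
      obtain ⟨k, -, hk⟩ := hK (v j) (hvT j).2.1 (hvT j).2.2.1
      exact ⟨k, hk⟩
    refine ⟨Nat.find hex, ?_, ?_, Nat.find_spec hex⟩
    · obtain ⟨k, hk1, hk⟩ := hK (v j) (hvT j).2.1 (hvT j).2.2.1
      exact (Nat.find_min' hex hk).trans hk1
    · intro i hi
      have := Nat.find_min hex hi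
      push Not at this
      exact this
  obtain ⟨k, hkK, hk⟩ := (Ultrafilter.eventually_exists_mem_iff (f := l) (Set.finite_Iic K)).1
    (Filter.Eventually.of_forall hfirst)
  have hFab : ∀ᶠ j in (l : Filter ℕ), F (v j) = eval (v j) (a k) / eval (v j) (b k) := by
    filter_upwards [hk] with j hj
    exact hab (v j) (hvT j).2.1 (hvT j).2.2.1 k hkK hj.1 hj.2
  obtain ⟨p, hp, w, hw1, hw2, hw3⟩ := ultra l hl v U H (a k) (b k)
    (Filter.Eventually.of_forall fun j => (hvT j).2.2.1) (hk.mono fun j hj => hj.2)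
    (htend.mono_left hl) (hFab.mono fun j hj => by rw [← hj]; exact hFT _ (hvT j))
    (hFab.mono fun j hj => by
      rw [← hj]
      have h1 := hvlt j
      have h2 := hFT _ (hvT j)
      have h3 : 0 < (eval (v j) U / eval (v j) H) ^ j := pow_pos (hu1 _ (hvT j)) j
      have h4 : 0 < F (v j) * (eval (v j) U / eval (v j) H) ^ j := mul_pos h2 h3
      have h5 : (0:ℝ) ≤ j := Nat.cast_nonneg j
      nlinarith [mul_nonneg h5 h4.le])
  have hpz : ∀ᶠ j in (l : Filter ℕ), ∀ q ∈ p, eval (v j) q = 0 := by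
    obtain ⟨s, hs⟩ := (inferInstance : IsNoetherianRing (MvPolynomial (Fin n) ℝ)).noetherian p
    have h1 : ∀ᶠ j in (l : Filter ℕ), ∀ q ∈ s, eval (v j) q = 0 := by
      rw [Filter.eventually_all_finset]
      intro q hq
      rw [← hp, ← hs]
      exact Submodule.subset_span hq
    filter_upwards [h1] with j hj q hq
    have h2 : p ≤ RingHom.ker (eval (v j)) := by
      rw [← hs]
      exact Submodule.span_le.2 fun q hq => hj q hq
    exact h2 hq
  have hne : ∀ᶠ j in (l : Filter ℕ),
      eval (v j) (mkDerivation ℝ w (a k) * (b k) - (a k) * mkDerivation ℝ w (b k)) ≠ 0 := by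
    rw [hp] at hw3
    exact Ultrafilter.eventually_not.2 hw3
  have hc : c ∈ p ∨ ∀ᶠ j in (l : Filter ℕ), 0 < eval (v j) c := by
    by_cases h : c ∈ p
    · exact Or.inl h
    · right
      rw [hp] at h
      filter_upwards [Ultrafilter.eventually_not.2 h] with j hj
      exact lt_of_le_of_ne (hvT j).2.2.2 (Ne.symm hj)
  have hJp : ∀ q ∈ J, q ∈ p := fun q hq => (hp q).2 (Filter.Eventually.of_forall fun j => (hvT j).2.1 q hq)
  have hbp : ∀ i < k, b i ∈ p := fun i hi => (hp _).2 (hk.mono fun j hj => hj.1 i hi)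
  have hc' : ∀ᶠ j in (l : Filter ℕ), c ∈ p ∨ 0 < eval (v j) c := by
    rcases hc with h | h
    · exact Filter.Eventually.of_forall fun j => Or.inl h
    · exact h.mono fun j hj => Or.inr hj
  obtain ⟨j, hj1, hj2, hj3, hj4, hj5⟩ := (hk.and (hFab.and (hpz.and (hne.and hc')))).exists
  have hfin : ∀ y, y ∈ O → (∀ q ∈ p, eval y q = 0) → eval y H ≠ 0 → eval y (b k) ≠ 0 →
      eval y U / eval y H = eval (v j) U / eval (v j) H → 
      eval y (a k) / eval y (b k) < eval (v j) (a k) / eval (v j) (b k) → 0 ≤ eval y c → False := by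
    intro y h1 h2 h3 h4 h5 h6 h7
    have hyJ : ∀ q ∈ J, eval y q = 0 := fun q hq => h2 q (hJp q hq)
    have hyT : y ∈ T := ⟨(hOC y hyJ h3).1 h1, hyJ, h3, h7⟩
    have h8 := hvmin j y hyT h5.le
    rw [hj2, hab y hyJ h3 k hkK (fun i hi => h2 _ (hbp i hi)) h4] at h8
    linarith
  have hvO : v j ∈ O := (hOC _ (hvT j).2.1 (hvT j).2.2.1).2 (hvT j).1
  rcases hj5 with h | h
  · obtain ⟨y, hyO, h1, h2, h3, h4, h5⟩ := descent p w U H (a k) (b k) hw1 hw2 (v j) hj3 (hvT j).2.2.1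
      hj1.2 hj4 O (hO.mem_nhds hvO)
    exact hfin y hyO h1 h2 h3 h4 h5 (h1 c h).ge
  · obtain ⟨y, hyO, h1, h2, h3, h4, h5⟩ := descent p w U H (a k) (b k) hw1 hw2 (v j) hj3 (hvT j).2.2.1
      hj1.2 hj4 (O ∩ {x | 0 < eval x c}) (Filter.inter_mem (hO.mem_nhds hvO)
        ((isOpen_lt continuous_const (MvPolynomial.continuous_eval c)).mem_nhds h))
    exact hfin y hyO.1 h1 h2 h3 h4 h5 (le_of_lt hyO.2)


lemma coeff_of_limit (k : ℕ) : ∀ (A : Polynomial ℝ) (φ : ℝ → ℝ) (L : ℝ),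
    Filter.Tendsto φ (nhdsWithin 0 {0}ᶜ) (nhds L) →
    (∀ᶠ t in nhdsWithin (0:ℝ) {0}ᶜ, A.eval t = t ^ k * φ t) → A.coeff k = L := by
  induction k with
  | zero =>
    intro A φ L h1 h2
    have h3 : Filter.Tendsto (fun t => A.eval t) (nhdsWithin 0 {0}ᶜ) (nhds (A.eval 0)) :=
      A.continuous.continuousAt.mono_left nhdsWithin_le_nhds
    rw [Polynomial.coeff_zero_eq_eval_zero]
    refine tendsto_nhds_unique h3 (h1.congr' ?_)
    filter_upwards [h2] with t ht
    rw [ht]; simp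
  | succ k ih =>
    intro A φ L h1 h2
    have h3 : Filter.Tendsto (fun t => A.eval t) (nhdsWithin 0 {0}ᶜ) (nhds (A.eval 0)) :=
      A.continuous.continuousAt.mono_left nhdsWithin_le_nhds
    have hid : Filter.Tendsto (fun t : ℝ => t ^ (k+1)) (nhdsWithin 0 {0}ᶜ) (nhds (0 ^ (k+1))) :=
      (continuous_pow (k+1)).continuousAt.mono_left nhdsWithin_le_nhds
    have h4 : A.eval 0 = 0 := by
      have h5 := hid.mul h1
      rw [zero_pow (Nat.succ_ne_zero k), zero_mul] at h5
      refine tendsto_nhds_unique h3 (h5.congr' ?_)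
      filter_upwards [h2] with t ht
      exact ht.symm
    have h6 : A = A.divX * Polynomial.X := by
      conv_lhs => rw [← Polynomial.divX_mul_X_add A]
      rw [Polynomial.coeff_zero_eq_eval_zero, h4]; simp
    have h7 : A.divX.coeff k = L := by
      refine ih A.divX φ L h1 ?_
      filter_upwards [h2, self_mem_nhdsWithin] with t ht ht0
      rw [h6, Polynomial.eval_mul, Polynomial.eval_X] at ht
      have ht0' : t ≠ 0 := ht0
      apply mul_right_cancel₀ ht0'
      rw [ht]; ring
    rw [← h7, Polynomial.coeff_divX]

lemma stratify {n : ℕ} (g : (Fin n → ℝ) → ℝ) (hg : IsRegulous g) :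
    ∃ (K : ℕ) (a b : ℕ → MvPolynomial (Fin n) ℝ), (∀ x, ∃ k ≤ K, eval x (b k) ≠ 0) ∧
      ∀ x k, (∀ i < k, eval x (b i) = 0) → eval x (b k) ≠ 0 → g x = eval x (a k) / eval x (b k) := by
  obtain ⟨hcont, U, ⟨-, m, s, hs⟩, ⟨c, hc⟩, p₀, q₀, hq₀, hpq₀⟩ := hg
  have hUe : ∀ x, x ∈ U ↔ ∃ i, eval x (s i) ≠ 0 := by
    intro x
    have : x ∈ univ \ U ↔ ∀ i, eval x (s i) = 0 := by rw [hs]; rfl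
    rw [← not_iff_not]
    push Not
    rw [← this]; simp
  obtain ⟨i₀, hi₀⟩ := (hUe c).1 hc
  obtain ⟨p, q, hqc, hpq⟩ : ∃ p q : MvPolynomial (Fin n) ℝ, eval c q ≠ 0 ∧
      ∀ x, eval x q ≠ 0 → g x * eval x q = eval x p := by
    refine ⟨p₀ * s i₀, q₀ * s i₀, ?_, ?_⟩
    · rw [map_mul]; exact mul_ne_zero (hq₀ c hc) hi₀
    · intro x hx
      rw [map_mul] at hx
      have hxU : x ∈ U := (hUe x).2 ⟨i₀, right_ne_zero_of_mul hx⟩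
      rw [hpq₀ x hxU, map_mul, map_mul]
      have := hq₀ x hxU
      field_simp
  let Φ : MvPolynomial (Fin n) ℝ →+* Polynomial (MvPolynomial (Fin n) ℝ) :=
    eval₂Hom (Polynomial.C.comp MvPolynomial.C)
      (fun i => Polynomial.C (X i) + Polynomial.X * Polynomial.C (MvPolynomial.C (c i) - X i))
  have hΦ : ∀ (x : Fin n → ℝ) (t : ℝ) (r : MvPolynomial (Fin n) ℝ),
      ((Φ r).map (eval x)).eval t = eval (fun i => x i + t * (c i - x i)) r := by
    intro x t r
    have : ((Polynomial.evalRingHom t).comp ((Polynomial.mapRingHom (eval x)).comp Φ)) =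
        eval (fun i => x i + t * (c i - x i)) := by
      apply MvPolynomial.ringHom_ext
      · intro r; simp [Φ]
      · intro i; simp [Φ]
    exact congrArg (fun f => f r) this
  refine ⟨(Φ q).natDegree, fun k => (Φ p).coeff k, fun k => (Φ q).coeff k, ?_, ?_⟩
  · intro x
    by_contra hcon
    push Not at hcon
    have h0 : (Φ q).map (eval x) = 0 := by
      ext k
      rw [Polynomial.coeff_map, Polynomial.coeff_zero]
      by_cases hk : k ≤ (Φ q).natDegree
      · exact hcon k hk
      · rw [Polynomial.coeff_eq_zero_of_natDegree_lt (not_le.1 hk), map_zero]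
    have h1 := hΦ x 1 q
    rw [h0, Polynomial.eval_zero] at h1
    apply hqc
    rw [h1]
    congr 2
    funext i; ring
  · intro x k hlt hk
    obtain ⟨B, hB⟩ : Polynomial.X ^ k ∣ (Φ q).map (eval x) := by
      rw [Polynomial.X_pow_dvd_iff]
      intro d hd
      rw [Polynomial.coeff_map]; exact hlt d hd
    have hB0 : B.eval 0 = eval x ((Φ q).coeff k) := by
      rw [← Polynomial.coeff_map, hB, ← Polynomial.coeff_zero_eq_eval_zero]
      have := Polynomial.coeff_X_pow_mul B k 0
      rw [zero_add] at this
      exact this.symm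
    have hBc : Filter.Tendsto (fun t => B.eval t) (nhdsWithin 0 {0}ᶜ) (nhds (B.eval 0)) :=
      B.continuous.continuousAt.mono_left nhdsWithin_le_nhds
    have hgc : Filter.Tendsto (fun t : ℝ => g (fun i => x i + t * (c i - x i))) (nhdsWithin 0 {0}ᶜ)
        (nhds (g x)) := by
      have h1 : Continuous (fun t : ℝ => g (fun i => x i + t * (c i - x i))) := by
        apply hcont.comp
        fun_prop
      have h2 := (h1.continuousAt (x := 0)).tendsto.mono_left (nhdsWithin_le_nhds (s := {0}ᶜ))
      simpa using h2
    have hmain := coeff_of_limit k ((Φ p).map (eval x)) _ _ (hBc.mul hgc) (by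
      filter_upwards [hBc.eventually_ne (by rw [hB0]; exact hk), self_mem_nhdsWithin] with t ht ht0
      have ht0' : t ≠ 0 := ht0
      have h1 : eval (fun i => x i + t * (c i - x i)) q = t ^ k * B.eval t := by
        rw [← hΦ, hB]; simp
      rw [hΦ, ← hpq _ (by rw [h1]; exact mul_ne_zero (pow_ne_zero _ ht0') ht), h1]
      ring)
    rw [Polynomial.coeff_map, hB0] at hmain
    show g x = eval x ((Φ p).coeff k) / eval x ((Φ q).coeff k)
    rw [hmain]
    exact (mul_div_cancel_left₀ _ hk).symm


lemma real_step (α β γ E s G1 G2 R : ℝ) (hα : 0 < α) (hβ : 0 < β) (hγ : 0 < γ) (hs : 0 ≤ s)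
    (hG1 : 0 ≤ G1) (hG2 : 0 ≤ G2) (hE : s * α ≤ E) (hR : R ≤ 0 → β ≤ G1 * s) :
    0 < R * (α * β * γ) + E * (G1 * γ + G2 * β) * (1 + R ^ 2) := by
  have hE0 : 0 ≤ E := le_trans (by positivity) hE
  have hαβγ : 0 < α * β * γ := by positivity
  by_cases h : R ≤ 0
  · have h1 := hR h
    have h2 : α * β * γ ≤ E * (G1 * γ + G2 * β) := by
      calc α * β * γ ≤ α * (G1 * s) * γ := by gcongr
        _ = (s * α) * (G1 * γ) := by ring
        _ ≤ E * (G1 * γ + G2 * β) := by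
          gcongr
          have : 0 ≤ G2 * β := by positivity
          linarith
    have h3 : (α * β * γ) * (1 + R ^ 2) ≤ E * (G1 * γ + G2 * β) * (1 + R ^ 2) := by gcongr
    have h4 : 0 < (α * β * γ) * (R + (1 + R ^ 2)) := mul_pos hαβγ (by nlinarith [sq_nonneg (R + 1), sq_nonneg R])
    linarith
  · push Not at h
    have h1 : 0 < R * (α * β * γ) := by positivity
    have h2 : 0 ≤ E * (G1 * γ + G2 * β) * (1 + R ^ 2) := by positivity
    linarith

lemma separator {n : ℕ} (J : Set (MvPolynomial (Fin n) ℝ)) (H : MvPolynomial (Fin n) ℝ)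
    (hH : ∀ x, 0 ≤ eval x H) (O C : Set (Fin n → ℝ)) (hO : IsOpen O) (hC : IsClosed C)
    (hOC : ∀ x, (∀ q ∈ J, eval x q = 0) → eval x H ≠ 0 → (x ∈ O ↔ x ∈ C))
    (g : (Fin n → ℝ) → ℝ) (hg : Continuous g)
    (hCg : ∀ x, (∀ q ∈ J, eval x q = 0) → eval x H ≠ 0 → (x ∈ C ↔ 0 < g x))
    (K : ℕ) (a b : ℕ → MvPolynomial (Fin n) ℝ)
    (hK : ∀ x, ∃ k ≤ K, eval x (b k) ≠ 0)
    (hab : ∀ x k, (∀ i < k, eval x (b i) = 0) → eval x (b k) ≠ 0 → g x = eval x (a k) / eval x (b k)) :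
    ∃ R : MvPolynomial (Fin n) ℝ, ∀ x, (∀ q ∈ J, eval x q = 0) → eval x H ≠ 0 →
      (0 < g x → 0 < eval x R) ∧ (g x ≤ 0 → eval x R < 0) := by
  obtain ⟨Gf, Nf, hGf, hLf⟩ := lojasiewicz J H 0 hH O C hO hC hOC g hg
    (fun x hx h1 h2 _ => (hCg x h1 h2).1 hx) K a b (fun x _ _ => hK x)
    (fun x _ _ k _ h1 h2 => hab x k h1 h2)
  have step : ∀ k, (∃ R : MvPolynomial (Fin n) ℝ, ∀ x, (∀ q ∈ J, eval x q = 0) → eval x H ≠ 0 →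
      (∀ i < k + 1, eval x (b i) = 0) → (0 < g x → 0 < eval x R) ∧ (g x ≤ 0 → eval x R < 0)) →
      (∃ R : MvPolynomial (Fin n) ℝ, ∀ x, (∀ q ∈ J, eval x q = 0) → eval x H ≠ 0 →
      (∀ i < k, eval x (b i) = 0) → (0 < g x → 0 < eval x R) ∧ (g x ≤ 0 → eval x R < 0)) := by
    rintro k ⟨R, hR⟩
    set Jk : Set (MvPolynomial (Fin n) ℝ) := J ∪ b '' Set.Iio k with hJk
    have hJk' : ∀ x, (∀ q ∈ Jk, eval x q = 0) ↔ (∀ q ∈ J, eval x q = 0) ∧ ∀ i < k, eval x (b i) = 0 := by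
      intro x
      constructor
      · intro h
        exact ⟨fun q hq => h q (Or.inl hq), fun i hi => h _ (Or.inr ⟨i, hi, rfl⟩)⟩
      · rintro ⟨h1, h2⟩ q (hq | ⟨i, hi, rfl⟩)
        · exact h1 q hq
        · exact h2 i hi
    have hsucc : ∀ x, (∀ i < k, eval x (b i) = 0) → eval x (b k) = 0 → ∀ i < k + 1, eval x (b i) = 0 := by
      intro x h1 h2 i hi
      rcases Nat.lt_succ_iff_lt_or_eq.1 hi with h | h
      · exact h1 i h
      · rw [h]; exact h2
    have hFb : Continuous (fun x => eval x (b k ^ 2)) := MvPolynomial.continuous_eval _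
    obtain ⟨G1, N1, hG1, hL1⟩ := lojasiewicz Jk H (-R) hH O C hO hC
      (fun x h1 h2 => hOC x ((hJk' x).1 h1).1 h2) (fun x => eval x (b k ^ 2)) hFb (by
        intro x hx h1 h2 h3
        obtain ⟨h4, h5⟩ := (hJk' x).1 h1
        rw [map_pow]
        have : eval x (b k) ≠ 0 := by
          intro h6
          have h7 := (hR x h4 h2 (hsucc x h5 h6)).1 ((hCg x h4 h2).1 hx)
          rw [map_neg] at h3
          linarith
        positivity) 0 (fun _ => b k ^ 2) (fun _ => 1) (by
          intro x _ _
          exact ⟨0, le_rfl, by simp⟩) (by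
          intro x _ _ _ _ _ _
          simp)
    obtain ⟨G2, N2, hG2, hL2⟩ := lojasiewicz Jk H R hH Cᶜ Oᶜ hC.isOpen_compl hO.isClosed_compl
      (fun x h1 h2 => not_congr (hOC x ((hJk' x).1 h1).1 h2).symm) (fun x => eval x (b k ^ 2)) hFb (by
        intro x hx h1 h2 h3
        obtain ⟨h4, h5⟩ := (hJk' x).1 h1
        rw [map_pow]
        have : eval x (b k) ≠ 0 := by
          intro h6
          have h8 : g x ≤ 0 := by
            by_contra h9
            exact hx ((hOC x h4 h2).2 ((hCg x h4 h2).2 (not_le.1 h9)))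
          have h7 := (hR x h4 h2 (hsucc x h5 h6)).2 h8
          linarith
        positivity) 0 (fun _ => b k ^ 2) (fun _ => 1) (by
          intro x _ _
          exact ⟨0, le_rfl, by simp⟩) (by
          intro x _ _ _ _ _ _
          simp)
    refine ⟨R * (H ^ Nf * H ^ N1 * H ^ N2) + (2 * a k * b k * Gf - b k ^ 2 * H ^ Nf) *
      (G1 * H ^ N2 + G2 * H ^ N1) * (1 + R ^ 2), ?_⟩
    intro x h1 h2 h3
    have hJx := (hJk' x).2 ⟨h1, h3⟩
    have hHx : 0 < eval x H := lt_of_le_of_ne (hH x) h2.symm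
    have hE : eval x (a k) * eval x (b k) = g x * eval x (b k) ^ 2 ∨ eval x (b k) = 0 := by
      by_cases h4 : eval x (b k) = 0
      · exact Or.inr h4
      · left
        rw [hab x k h3 h4]
        field_simp
    have hE' : eval x (2 * a k * b k * Gf - b k ^ 2 * H ^ Nf) =
        eval x (b k) ^ 2 * (2 * g x * eval x Gf - eval x H ^ Nf) := by
      simp only [map_sub, map_mul, map_pow, map_ofNat]
      rcases hE with h | h
      · linear_combination 2 * eval x Gf * h
      · rw [h]; ring
    have hev : eval x (R * (H ^ Nf * H ^ N1 * H ^ N2) + (2 * a k * b k * Gf - b k ^ 2 * H ^ Nf) *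
      (G1 * H ^ N2 + G2 * H ^ N1) * (1 + R ^ 2)) = eval x R * (eval x H ^ Nf * eval x H ^ N1 * eval x H ^ N2)
       + eval x (2 * a k * b k * Gf - b k ^ 2 * H ^ Nf) *
      (eval x G1 * eval x H ^ N2 + eval x G2 * eval x H ^ N1) * (1 + eval x R ^ 2) := by
      simp only [map_add, map_mul, map_pow, map_one]
    have hb2 : 0 ≤ eval x (b k) ^ 2 := sq_nonneg _
    constructor
    · intro hgx
      have hxC := (hCg x h1 h2).2 hgx
      rw [hev]
      refine real_step _ _ _ _ (eval x (b k) ^ 2) _ _ _ (by positivity) (by positivity) (by positivity)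
        hb2 (hG1 x) (hG2 x) ?_ ?_
      · rw [hE']
        have := hLf x hxC h1 h2 (by simp)
        apply mul_le_mul_of_nonneg_left _ hb2
        linarith
      · intro hRx
        have := hL1 x hxC hJx h2 (by rw [map_neg]; linarith)
        rwa [map_pow] at this
    · intro hgx
      have hxC : x ∉ C := fun h => absurd ((hCg x h1 h2).1 h) (not_lt.2 hgx)
      have hxO : x ∈ Oᶜ := fun h => hxC ((hOC x h1 h2).1 h)
      rw [hev]
      have := real_step (eval x H ^ Nf) (eval x H ^ N2) (eval x H ^ N1)
        (- eval x (2 * a k * b k * Gf - b k ^ 2 * H ^ Nf)) (eval x (b k) ^ 2) (eval x G2) (eval x G1)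
        (- eval x R) (by positivity) (by positivity) (by positivity)
        hb2 (hG2 x) (hG1 x) (by
          rw [hE']
          have h5 : g x * eval x Gf ≤ 0 := mul_nonpos_of_nonpos_of_nonneg hgx (hGf x)
          rw [← mul_neg]
          apply mul_le_mul_of_nonneg_left _ hb2
          linarith) (by
          intro hRx
          have := hL2 x hxO hJx h2 (by linarith)
          rwa [map_pow] at this)
      nlinarith [this]
  have hall : ∀ k, (∃ R : MvPolynomial (Fin n) ℝ, ∀ x, (∀ q ∈ J, eval x q = 0) → eval x H ≠ 0 →
      (∀ i < k, eval x (b i) = 0) → (0 < g x → 0 < eval x R) ∧ (g x ≤ 0 → eval x R < 0)) →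
      (∃ R : MvPolynomial (Fin n) ℝ, ∀ x, (∀ q ∈ J, eval x q = 0) → eval x H ≠ 0 →
      (∀ i < 0, eval x (b i) = 0) → (0 < g x → 0 < eval x R) ∧ (g x ≤ 0 → eval x R < 0)) := by
    intro k
    induction k with
    | zero => exact id
    | succ k ih => exact fun h => ih (step k h)
  obtain ⟨R, hR⟩ := hall (K + 1) ⟨0, by
    intro x _ _ h
    obtain ⟨k, hk, hk'⟩ := hK x
    exact absurd (h k (by omega)) hk'⟩
  exact ⟨R, fun x h1 h2 => hR x h1 h2 (fun i hi => absurd hi (Nat.not_lt_zero i))⟩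


lemma zar_eq {n : ℕ} (X E : Set (Fin n → ℝ)) : ∃ h : MvPolynomial (Fin n) ℝ, (∀ x, 0 ≤ eval x h) ∧
    (∀ x ∈ E, eval x h = 0) ∧ ∀ x, eval x h = 0 → x ∈ zarClosureIn X E := by
  obtain ⟨s, hs⟩ := (inferInstance : IsNoetherianRing (MvPolynomial (Fin n) ℝ)).noetherian (vanishingIdealOf E)
  have hev : ∀ x, eval x (∑ q ∈ s, q ^ 2) = ∑ q ∈ s, eval x q ^ 2 := by intro x; simp
  refine ⟨∑ q ∈ s, q ^ 2, ?_, ?_, ?_⟩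
  · intro x
    rw [hev]
    exact Finset.sum_nonneg fun q _ => sq_nonneg _
  · intro x hx
    rw [hev]
    apply Finset.sum_eq_zero
    intro q hq
    have : q ∈ vanishingIdealOf E := by rw [← hs]; exact Submodule.subset_span hq
    rw [this x hx]; simp
  · rintro x hx V ⟨⟨⟨k, p, rfl⟩, -⟩, hEV⟩ i
    rw [hev, Finset.sum_eq_zero_iff_of_nonneg (fun q _ => sq_nonneg _)] at hx
    have h2 : vanishingIdealOf E ≤ RingHom.ker (eval x) := by
      rw [← hs]
      exact Submodule.span_le.2 fun q hq => pow_eq_zero_iff (two_ne_zero) |>.1 (hx q hq)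
    exact h2 (show p i ∈ vanishingIdealOf E from fun y hy => hEV hy i)

lemma regular_part {n : ℕ} (X : Set (Fin n → ℝ)) (f : (Fin n → ℝ) → ℝ) :
    ∃ r : MvPolynomial (Fin n) ℝ, ∀ x ∈ X, (f x ≤ 0 → eval x r ≤ 0) ∧ (0 < f x → 0 ≤ eval x r) ∧
      (0 < f x → x ∈ regularDomain X f → 0 < eval x r) := by
  let Γ : Set (MvPolynomial (Fin n) ℝ) := {e | ∃ p q : MvPolynomial (Fin n) ℝ, ∀ x ∈ X, eval x e ≠ 0 →
    eval x q ≠ 0 ∧ f x = eval x p / eval x q}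
  have hΓ : ∀ x ∈ regularDomain X f, ∃ e ∈ Γ, eval x e ≠ 0 := by
    rintro x ⟨U, ⟨⟨hUX, m, s, hs⟩, p, q, hq, hpq⟩, hxU⟩
    have hUe : ∀ y ∈ X, (y ∉ U ↔ ∀ i, eval y (s i) = 0) := by
      intro y hy
      have : y ∈ X \ U ↔ ∀ i, eval y (s i) = 0 := by rw [hs]; rfl
      rw [← this]; simp [hy]
    have h1 : ∃ i, eval x (s i) ≠ 0 := by
      by_contra hcon
      push Not at hcon
      exact (hUe x (hUX hxU)).2 hcon hxU
    obtain ⟨i, hi⟩ := h1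
    refine ⟨s i, ⟨p, q, fun y hy hyi => ?_⟩, hi⟩
    have hyU : y ∈ U := by
      by_contra hcon
      exact hyi ((hUe y hy).1 hcon i)
    exact ⟨hq y hyU, hpq y hyU⟩
  obtain ⟨t, htΓ, ht⟩ := (Submodule.fg_span_iff_fg_span_finset_subset Γ).1
    ((inferInstance : IsNoetherianRing (MvPolynomial (Fin n) ℝ)).noetherian (Ideal.span Γ))
  choose! P Q hPQ using fun e (he : e ∈ Γ) => he
  have hterm : ∀ x ∈ X, ∀ e ∈ t, eval x (e ^ 2 * P e * Q e) = f x * (eval x e * eval x (Q e)) ^ 2 := by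
    intro x hx e he
    simp only [map_mul, map_pow]
    by_cases h0 : eval x e = 0
    · rw [h0]; ring
    · obtain ⟨h1, h2⟩ := hPQ e (htΓ he) x hx h0
      rw [h2]; field_simp
  refine ⟨∑ e ∈ t, e ^ 2 * P e * Q e, fun x hx => ?_⟩
  rw [map_sum, Finset.sum_congr rfl (hterm x hx)]
  refine ⟨?_, ?_, ?_⟩
  · intro h
    exact Finset.sum_nonpos fun e _ => mul_nonpos_of_nonpos_of_nonneg h (sq_nonneg _)
  · intro h
    exact Finset.sum_nonneg fun e _ => mul_nonneg h.le (sq_nonneg _)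
  · intro h hxr
    apply Finset.sum_pos'
    · exact fun e _ => mul_nonneg h.le (sq_nonneg _)
    · by_contra hcon
      push Not at hcon
      have hz : ∀ e ∈ t, eval x e = 0 := by
        intro e he
        by_contra h0
        have h1 := (hPQ e (htΓ he) x hx h0).1
        have h2 := hcon e he
        have h3 : 0 < f x * (eval x e * eval x (Q e)) ^ 2 := by positivity
        linarith
      obtain ⟨e, he, he0⟩ := hΓ x hxr
      have h4 : Ideal.span Γ ≤ RingHom.ker (eval x) := by
        show Submodule.span _ Γ ≤ _
        rw [ht]
        exact Submodule.span_le.2 fun q hq => hz q hq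
      exact he0 (h4 (Submodule.subset_span he))

theorem regulous_principal_approximation {n : ℕ} (X : Set (Fin n → ℝ))
    (hX : IsRealAlgebraicSet X) (f : (Fin n → ℝ) → ℝ) (hf : IsRegulousOn X f) :
    ∃ r : MvPolynomial (Fin n) ℝ,
      {x ∈ X | 0 < MvPolynomial.eval x r} ⊆ {x ∈ X | 0 < f x} ∧
      {x ∈ X | 0 < f x} \ {x ∈ X | 0 < MvPolynomial.eval x r} ⊆
        zarClosureIn X (bdIn X {x ∈ X | 0 < f x}) ∩ polarLocus X f := by
  obtain ⟨g, hg, hfg⟩ := hf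
  obtain ⟨h, hh0, hhE, hhZ⟩ := zar_eq X (bdIn X {x ∈ X | 0 < f x})
  obtain ⟨r₀, hr₀⟩ := regular_part X f
  obtain ⟨K, a, b, hK, hab⟩ := stratify g hg
  obtain ⟨m, s, hs⟩ := hX
  have hJ : ∀ x, (∀ q ∈ Set.range s, eval x q = 0) ↔ x ∈ X := by
    intro x
    rw [hs]
    simp
  have hcl : ∀ x, x ∈ X → eval x h ≠ 0 → (x ∈ closure {x ∈ X | 0 < f x} ↔ 0 < g x) := by
    intro x hx hxh
    constructor
    · intro hxc
      by_contra hcon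
      apply hxh
      apply hhE
      refine ⟨⟨hxc, hx⟩, ?_⟩
      rintro ⟨-, U, -, hxU, hUS⟩
      have := (hUS ⟨hxU, hx⟩).2
      rw [hfg x hx] at this
      exact hcon this
    · intro hgx
      exact subset_closure ⟨hx, by rw [hfg x hx]; exact hgx⟩
  obtain ⟨R, hR⟩ := separator (Set.range s) h hh0 {x | 0 < g x} (closure {x ∈ X | 0 < f x})
    (isOpen_lt continuous_const hg.1) isClosed_closure
    (fun x h1 h2 => (hcl x ((hJ x).1 h1) h2).symm) g hg.1
    (fun x h1 h2 => hcl x ((hJ x).1 h1) h2) K a b hK hab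
  refine ⟨h * R + r₀, ?_, ?_⟩
  · rintro x ⟨hx, hxr⟩
    refine ⟨hx, ?_⟩
    by_contra hcon
    push Not at hcon
    have h1 := (hr₀ x hx).1 hcon
    have h2 : eval x h * eval x R ≤ 0 := by
      by_cases h0 : eval x h = 0
      · rw [h0, zero_mul]
      · exact mul_nonpos_of_nonneg_of_nonpos (hh0 x)
          ((hR x ((hJ x).2 hx) h0).2 (by rw [← hfg x hx]; exact hcon)).le
    rw [map_add, map_mul] at hxr
    linarith
  · rintro x ⟨⟨hx, hfx⟩, hxr⟩
    have hxr' : eval x h * eval x R + eval x r₀ ≤ 0 := by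
      by_contra hcon
      exact hxr ⟨hx, by rw [map_add, map_mul]; exact not_le.1 hcon⟩
    obtain ⟨-, h2, h3⟩ := hr₀ x hx
    have h2 := h2 hfx
    have h4 : eval x h = 0 := by
      by_contra h0
      have h5 := (hR x ((hJ x).2 hx) h0).1 (by rw [← hfg x hx]; exact hfx)
      have h6 : 0 < eval x h * eval x R := mul_pos (lt_of_le_of_ne (hh0 x) (Ne.symm h0)) h5
      linarith
    refine ⟨hhZ x h4, hx, fun hreg => ?_⟩
    have h7 := h3 hfx hreg
    rw [h4, zero_mul] at hxr'
    linarith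
end

section
/- Let X ⊆ ℝⁿ be a real algebraic set, let f be a regulous function on X and set S = S(f) = {x ∈ X : f(x) > 0}. Then S is a principal open semi-algebraic set, i.e. there exists a polynomial function p on X with S = {x ∈ X : p(x) > 0}, if and only if S ∩ Zar(Bd(S)) = ∅, where Zar(Bd(S)) denotes the Zariski closure in X of the euclidean boundary Bd(S) of S. -/
open MvPolynomial Set


/-- one breakpoint order isomorphism -/
noncomputable def kinkIso (c s : ℝ) (hs : 0 < s) : ℝ ≃o ℝ where
  toFun x := if x ≤ c then x else c + s * (x - c)
  invFun x := if x ≤ c then x else c + s⁻¹ * (x - c)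
  left_inv x := by
    by_cases h : x ≤ c
    · simp [h]
    · have : ¬ (c + s * (x - c) ≤ c) := by
        have := mul_pos hs (sub_pos.2 (not_le.1 h)); linarith
      simp only [h, if_false, this]
      field_simp; ring
  right_inv x := by
    by_cases h : x ≤ c
    · simp [h]
    · have : ¬ (c + s⁻¹ * (x - c) ≤ c) := by
        have := mul_pos (inv_pos.2 hs) (sub_pos.2 (not_le.1 h)); linarith
      simp only [h, if_false, this]
      field_simp; ring
  map_rel_iff' := by
    have key : StrictMono (fun x : ℝ => if x ≤ c then x else c + s * (x - c)) := by
      intro x y hxy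
      dsimp only
      split_ifs with h1 h2 h2
      · exact hxy
      · have := mul_pos hs (sub_pos.2 (not_le.1 h2)); linarith
      · linarith
      · have := mul_pos hs (sub_pos.2 hxy); nlinarith
    intro a b
    exact key.le_iff_le

lemma kinkIso_le {c s : ℝ} (hs : 0 < s) {x : ℝ} (h : x ≤ c) : kinkIso c s hs x = x := by
  show (if x ≤ c then x else c + s * (x - c)) = x
  simp [h]

lemma kinkIso_ge {c s : ℝ} (hs : 0 < s) {x : ℝ} (h : c ≤ x) :
    kinkIso c s hs x = c + s * (x - c) := by
  show (if x ≤ c then x else c + s * (x - c)) = _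
  split_ifs with h1
  · have : x = c := le_antisymm h1 h
    simp [this]
  · rfl

lemma exists_move {l z w u : ℝ} (h1 : l < z) (h2 : z < u) (h3 : l < w) (h4 : w < u) :
    ∃ τ : ℝ ≃o ℝ, τ z = w ∧ ∀ x, (x ≤ l ∨ u ≤ x) → τ x = x := by
  have ha : 0 < (w - l) / (z - l) := div_pos (by linarith) (by linarith)
  have hb : 0 < (u - w) / (u - z) := div_pos (by linarith) (by linarith)
  set a := (w - l) / (z - l) with had
  set b := (u - w) / (u - z) with hbd
  have ea : a * (z - l) = w - l := by rw [had]; field_simp [(sub_pos.2 h1).ne']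
  have eb : b * (u - z) = u - w := by rw [hbd]; field_simp [(sub_pos.2 h2).ne']
  have hba : 0 < b / a := div_pos hb ha
  have hbi : 0 < b⁻¹ := inv_pos.2 hb
  refine ⟨((kinkIso l a ha).trans (kinkIso w (b / a) hba)).trans (kinkIso u b⁻¹ hbi), ?_, ?_⟩
  · simp only [OrderIso.trans_apply]
    rw [kinkIso_ge ha h1.le, kinkIso_le hba (by linarith), kinkIso_le hbi (by linarith)]
    linarith
  · rintro x (hx | hx)
    · simp only [OrderIso.trans_apply]
      rw [kinkIso_le ha hx, kinkIso_le hba (by linarith), kinkIso_le hbi (by linarith)]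
    · simp only [OrderIso.trans_apply]
      have h5 : w ≤ l + a * (x - l) := by nlinarith
      have h6 : w + b / a * (l + a * (x - l) - w) = u + b * (x - u) := by
        have : l + a * (x - l) - w = a * (x - z) := by linarith
        rw [this, div_mul_eq_mul_div, mul_div_assoc, mul_div_cancel_left₀ _ ha.ne']
        linarith
      rw [kinkIso_ge ha (by linarith), kinkIso_ge hba h5, h6, kinkIso_ge hbi (by nlinarith)]
      field_simp; ring

lemma core_final {l u x : ℝ} {f g : ℝ → ℝ} (hf : Continuous f)
    (hlx : l < x) (hxu : x < u)
    (hl : SignType.sign (f l) = SignType.sign (g l))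
    (hu : SignType.sign (f u) = SignType.sign (g u))
    (hm : StrictMonoOn f (Icc l u)) (hm' : StrictMonoOn g (Icc l u))
    (h0 : ∀ y ∈ Ioo l u, f y ≠ 0) : SignType.sign (f x) = SignType.sign (g x) := by
  have ml : l ∈ Icc l u := ⟨le_rfl, by linarith⟩
  have mu : u ∈ Icc l u := ⟨by linarith, le_rfl⟩
  have mx : x ∈ Icc l u := ⟨by linarith, by linarith⟩
  by_cases c : 0 ≤ f l
  · have c' : 0 ≤ g l := by rw [← sign_nonneg_iff] at c ⊢; rwa [← hl]
    rw [sign_pos (c.trans_lt (hm ml mx hlx)), sign_pos (c'.trans_lt (hm' ml mx hlx))]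
  · push Not at c
    have d : f u ≤ 0 := by
      by_contra d
      push Not at d
      obtain ⟨y, hy, hy0⟩ := intermediate_value_Ioo (by linarith : l ≤ u) hf.continuousOn ⟨c, d⟩
      exact h0 y hy hy0
    have d' : g u ≤ 0 := by rw [← sign_nonpos_iff] at d ⊢; rwa [← hu]
    rw [sign_neg ((hm mx mu hxu).trans_le d), sign_neg ((hm' mx mu hxu).trans_le d')]

lemma core_root {l u z : ℝ} {f g : ℝ → ℝ} (hg : Continuous g)
    (hlz : l < z) (hzu : z < u)
    (hl : SignType.sign (f l) = SignType.sign (g l))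
    (hu : SignType.sign (f u) = SignType.sign (g u))
    (hm : StrictMonoOn f (Icc l u)) (h0 : f z = 0) : ∃ w, l < w ∧ w < u ∧ g w = 0 := by
  have ml : l ∈ Icc l u := ⟨le_rfl, by linarith⟩
  have mu : u ∈ Icc l u := ⟨by linarith, le_rfl⟩
  have mx : z ∈ Icc l u := ⟨by linarith, by linarith⟩
  have c := hm ml mx hlz
  have d := hm mx mu hzu
  rw [h0] at c d
  rw [← sign_eq_neg_one_iff, hl, sign_eq_neg_one_iff] at c
  rw [← sign_eq_one_iff, hu, sign_eq_one_iff] at d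
  obtain ⟨y, hy, hy0⟩ := intermediate_value_Ioo (by linarith : l ≤ u) hg.continuousOn ⟨c, d⟩
  exact ⟨y, hy.1, hy.2, hy0⟩

lemma exists_nbrs (K : Finset ℝ) {a b x : ℝ} (ha : a ∈ K) (hb : b ∈ K) (hax : a < x) (hxb : x < b)
    (hx : x ∉ K) : ∃ l ∈ K, ∃ u ∈ K, a ≤ l ∧ l < x ∧ x < u ∧ u ≤ b ∧ ∀ t ∈ K, ¬ (l < t ∧ t < u) := by
  obtain ⟨l, hl, hl'⟩ := (K.filter (· < x)).exists_max_image id ⟨a, by simp [ha, hax]⟩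
  obtain ⟨u, hu, hu'⟩ := (K.filter (x < ·)).exists_min_image id ⟨b, by simp [hb, hxb]⟩
  simp only [Finset.mem_filter, id] at hl hl' hu hu'
  refine ⟨l, hl.1, u, hu.1, hl' a ⟨ha, hax⟩, hl.2, hu.2, hu' b ⟨hb, hxb⟩, ?_⟩
  rintro t ht ⟨h1, h2⟩
  rcases lt_trichotomy t x with h | h | h
  · exact absurd (hl' t ⟨ht, h⟩) (not_le.2 h1)
  · exact hx (h ▸ ht)
  · exact absurd (hu' t ⟨ht, h⟩) (not_le.2 h2)

lemma core_iso (Z : Finset ℝ) : ∀ (K : Finset ℝ) (f g : ℝ → ℝ) (_ : Continuous f) (_ : Continuous g)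
    (_ : ∀ x ∈ K, SignType.sign (f x) = SignType.sign (g x)) (a b : ℝ) (_ : a ∈ K) (_ : b ∈ K)
    (_ : ∀ x ≤ a, SignType.sign (f x) = SignType.sign (g x))
    (_ : ∀ x, b ≤ x → SignType.sign (f x) = SignType.sign (g x))
    (_ : ∀ x y, x < y → (∀ t ∈ K, ¬ (x < t ∧ t < y)) →
      (StrictMonoOn f (Icc x y) ∧ StrictMonoOn g (Icc x y)) ∨
      (StrictAntiOn f (Icc x y) ∧ StrictAntiOn g (Icc x y)))
    (_ : ∀ x, f x = 0 → x ∈ K ∨ x ∈ Z),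
    ∃ τ : ℝ ≃o ℝ, (∀ x ∈ K, τ x = x) ∧ ∀ x, SignType.sign (f x) = SignType.sign (g (τ x)) := by
  induction Z using Finset.induction_on with
  | empty =>
    intro K f g hf hg hs a b ha hb hsa hsb hm h0
    refine ⟨OrderIso.refl ℝ, fun x _ => rfl, fun x => ?_⟩
    simp only [OrderIso.refl_apply]
    by_cases hx : x ∈ K
    · exact hs x hx
    by_cases hxa : x ≤ a
    · exact hsa x hxa
    by_cases hxb : b ≤ x
    · exact hsb x hxb
    push Not at hxa hxb
    obtain ⟨l, hl, u, hu, -, hlx, hxu, -, hfree⟩ := exists_nbrs K ha hb hxa hxb hx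
    have h0' : ∀ y ∈ Ioo l u, f y ≠ 0 := by
      intro y hy hy0
      rcases h0 y hy0 with h | h
      · exact hfree y h hy
      · simp at h
    rcases hm l u (hlx.trans hxu) hfree with ⟨h1, h2⟩ | ⟨h1, h2⟩
    · exact core_final hf hlx hxu (hs l hl) (hs u hu) h1 h2 h0'
    · have := core_final (f := fun x => - f x) (g := fun x => - g x) hf.neg hlx hxu
        (by simp [Left.sign_neg, hs l hl]) (by simp [Left.sign_neg, hs u hu]) h1.neg h2.neg
        (by intro y hy; simpa using h0' y hy)
      simpa [Left.sign_neg] using this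
  | insert z Z hz ih =>
    intro K f g hf hg hs a b ha hb hsa hsb hm h0
    by_cases hzK : z ∈ K
    · refine ih K f g hf hg hs a b ha hb hsa hsb hm ?_
      intro x hx
      rcases h0 x hx with h | h
      · exact Or.inl h
      · rcases Finset.mem_insert.1 h with h | h
        · exact Or.inl (h ▸ hzK)
        · exact Or.inr h
    by_cases hfz : f z = 0
    swap
    · refine ih K f g hf hg hs a b ha hb hsa hsb hm ?_
      intro x hx
      rcases h0 x hx with h | h
      · exact Or.inl h
      · rcases Finset.mem_insert.1 h with h | h
        · exact absurd (h ▸ hx) hfz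
        · exact Or.inr h
    have hmove : ∃ τ₁ : ℝ ≃o ℝ, g (τ₁ z) = 0 ∧ (∀ x ∈ K, τ₁ x = x) ∧ (∀ x ≤ a, τ₁ x = x) ∧
        (∀ x, b ≤ x → τ₁ x = x) := by
      by_cases hgz : g z = 0
      · exact ⟨OrderIso.refl ℝ, by simpa using hgz, by simp, by simp, by simp⟩
      have hne : SignType.sign (f z) ≠ SignType.sign (g z) := by
        rw [hfz]; simp only [sign_zero]; exact fun h => hgz (sign_eq_zero_iff.1 h.symm)
      have hza : a < z := by
        by_contra h; exact hne (hsa z (not_lt.1 h))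
      have hzb : z < b := by
        by_contra h; exact hne (hsb z (not_lt.1 h))
      obtain ⟨l, hl, u, hu, hal, hlx, hxu, hub, hfree⟩ := exists_nbrs K ha hb hza hzb hzK
      have hw : ∃ w, l < w ∧ w < u ∧ g w = 0 := by
        rcases hm l u (hlx.trans hxu) hfree with ⟨h1, h2⟩ | ⟨h1, h2⟩
        · exact core_root hg hlx hxu (hs l hl) (hs u hu) h1 hfz
        · have := core_root (f := fun x => - f x) (g := fun x => - g x) hg.neg hlx hxu
            (by simp [Left.sign_neg, hs l hl]) (by simp [Left.sign_neg, hs u hu]) h1.neg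
            (by simpa using hfz)
          simpa using this
      obtain ⟨w, hw1, hw2, hw3⟩ := hw
      obtain ⟨τ, ht1, ht2⟩ := exists_move hlx hxu hw1 hw2
      refine ⟨τ, by rw [ht1, hw3], ?_, fun x hx => ht2 x (Or.inl (by linarith)),
        fun x hx => ht2 x (Or.inr (by linarith))⟩
      intro x hx
      apply ht2
      by_contra h
      push Not at h
      exact hfree x hx h
    obtain ⟨τ₁, hτz, hτK, hτa, hτb⟩ := hmove
    obtain ⟨τ, hτ1, hτ2⟩ := ih (insert z K) f (fun x => g (τ₁ x)) hf (hg.comp τ₁.continuous)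
      (by
        intro x hx
        rcases Finset.mem_insert.1 hx with h | h
        · subst h; rw [hfz, hτz]
        · rw [hτK x h]; exact hs x h) a b (Finset.mem_insert_of_mem ha) (Finset.mem_insert_of_mem hb)
      (by intro x hx; rw [hτa x hx]; exact hsa x hx)
      (by intro x hx; rw [hτb x hx]; exact hsb x hx)
      (by
        intro x y hxy hfree
        have hlt : τ₁ x < τ₁ y := τ₁.lt_iff_lt.2 hxy
        have hmM : min x (τ₁ x) < max y (τ₁ y) :=
          (min_le_left _ _).trans_lt (hxy.trans_le (le_max_left _ _))
        have hfree' : ∀ t ∈ K, ¬ (min x (τ₁ x) < t ∧ t < max y (τ₁ y)) := by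
          rintro t ht ⟨h1, h2⟩
          have htt := hτK t ht
          have hxt : x < t := by
            by_contra h
            push Not at h
            have : τ₁ t ≤ τ₁ x := τ₁.le_iff_le.2 h
            rw [htt] at this
            exact absurd h1 (not_lt.2 (le_min h this))
          have hty : t < y := by
            by_contra h
            push Not at h
            have : τ₁ y ≤ τ₁ t := τ₁.le_iff_le.2 h
            rw [htt] at this
            exact absurd h2 (not_lt.2 (max_le h this))
          exact hfree t (Finset.mem_insert_of_mem ht) ⟨hxt, hty⟩
        have hsub : Icc x y ⊆ Icc (min x (τ₁ x)) (max y (τ₁ y)) :=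
          Icc_subset_Icc (min_le_left _ _) (le_max_left _ _)
        have hmap : ∀ t ∈ Icc x y, τ₁ t ∈ Icc (min x (τ₁ x)) (max y (τ₁ y)) := by
          intro t ht
          exact ⟨(min_le_right _ _).trans (τ₁.le_iff_le.2 ht.1),
            (τ₁.le_iff_le.2 ht.2).trans (le_max_right _ _)⟩
        rcases hm _ _ hmM hfree' with ⟨h1, h2⟩ | ⟨h1, h2⟩
        · left
          exact ⟨h1.mono hsub, fun s hs t ht hst => h2 (hmap s hs) (hmap t ht) (τ₁.lt_iff_lt.2 hst)⟩
        · right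
          exact ⟨h1.mono hsub, fun s hs t ht hst => h2 (hmap s hs) (hmap t ht) (τ₁.lt_iff_lt.2 hst)⟩)
      (by
        intro x hx
        rcases h0 x hx with h | h
        · exact Or.inl (Finset.mem_insert_of_mem h)
        · rcases Finset.mem_insert.1 h with h | h
          · exact Or.inl (h ▸ Finset.mem_insert_self _ _)
          · exact Or.inr h)
    refine ⟨τ.trans τ₁, ?_, ?_⟩
    · intro x hx
      simp only [OrderIso.trans_apply]
      rw [hτ1 x (Finset.mem_insert_of_mem hx), hτK x hx]
    · intro x
      simpa using hτ2 x

open Polynomial in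
lemma sign_eventually_atTop (P : ℝ[X]) :
    ∀ᶠ x in Filter.atTop, SignType.sign (P.eval x) = SignType.sign P.leadingCoeff := by
  by_cases h : P.natDegree = 0
  · rw [Polynomial.eq_C_of_natDegree_eq_zero h]; simp
  have hd : 0 < P.degree := Polynomial.natDegree_pos_iff_degree_pos.1 (Nat.pos_of_ne_zero h)
  have hP : P ≠ 0 := by rintro rfl; simp at h
  rcases lt_or_gt_of_ne (Polynomial.leadingCoeff_ne_zero.2 hP) with h1 | h1
  · have := P.tendsto_atBot_of_leadingCoeff_nonpos hd h1.le
    filter_upwards [this.eventually_lt_atBot 0] with x hx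
    rw [sign_neg hx, sign_neg h1]
  · have := P.tendsto_atTop_of_leadingCoeff_nonneg hd h1.le
    filter_upwards [this.eventually_gt_atTop 0] with x hx
    rw [sign_pos hx, sign_pos h1]

open Polynomial in
lemma sign_eventually_atBot (P : ℝ[X]) :
    ∀ᶠ x in Filter.atBot, SignType.sign (P.eval x) =
      SignType.sign ((-1) ^ P.natDegree * P.leadingCoeff) := by
  have := Filter.tendsto_neg_atBot_atTop.eventually (sign_eventually_atTop (P.comp (-Polynomial.X)))
  filter_upwards [this] with x hx
  rw [Polynomial.comp_neg_X_leadingCoeff_eq] at hx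
  simpa using hx

open Polynomial in
lemma deriv_mono (P : ℝ[X]) {x y : ℝ} (h : ∀ t ∈ Ioo x y, 0 < P.derivative.eval t) :
    StrictMonoOn (fun t => P.eval t) (Icc x y) := by
  apply strictMonoOn_of_deriv_pos (convex_Icc x y) P.continuous.continuousOn
  intro t ht
  rw [interior_Icc] at ht
  rw [Polynomial.deriv]; exact h t ht

open Polynomial in
lemma deriv_anti (P : ℝ[X]) {x y : ℝ} (h : ∀ t ∈ Ioo x y, P.derivative.eval t < 0) :
    StrictAntiOn (fun t => P.eval t) (Icc x y) := by
  apply strictAntiOn_of_deriv_neg (convex_Icc x y) P.continuous.continuousOn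
  intro t ht
  rw [interior_Icc] at ht
  rw [Polynomial.deriv]; exact h t ht

open Polynomial in
lemma sign_const_of_no_root (Q : ℝ[X]) {s t : ℝ} (h : ∀ r ∈ Set.uIcc s t, Q.eval r ≠ 0) :
    SignType.sign (Q.eval s) = SignType.sign (Q.eval t) := by
  have hs := h s left_mem_uIcc
  have ht := h t right_mem_uIcc
  have hc : ContinuousOn (fun r => Q.eval r) (uIcc s t) := Q.continuous.continuousOn
  have := intermediate_value_uIcc hc
  by_contra hne
  have h0 : (0:ℝ) ∈ uIcc (Q.eval s) (Q.eval t) := by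
    rw [mem_uIcc]
    rcases lt_or_gt_of_ne hs with h1 | h1 <;> rcases lt_or_gt_of_ne ht with h2 | h2
    · exact absurd (by rw [sign_neg h1, sign_neg h2]) hne
    · left; exact ⟨h1.le, h2.le⟩
    · right; exact ⟨h2.le, h1.le⟩
    · exact absurd (by rw [sign_pos h1, sign_pos h2]) hne
  obtain ⟨r, hr, hr0⟩ := this h0
  exact h r hr hr0

open Polynomial in
lemma step_iso (M : Multiset (ℝ[X] × ℝ[X])) (P P' : ℝ[X]) (hn : P.natDegree = P'.natDegree)
    (hpos : 0 < P.natDegree) (hlc : SignType.sign P.leadingCoeff = SignType.sign P'.leadingCoeff)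
    (φ : ℝ ≃o ℝ)
    (hM : ∀ q ∈ M, ∀ x, SignType.sign (q.1.eval x) = SignType.sign (q.2.eval (φ x)))
    (hd : ∀ x, SignType.sign (P.derivative.eval x) = SignType.sign (P'.derivative.eval (φ x)))
    (hr : ∀ q ∈ M, q.1.natDegree ≠ 0 → ∀ x, q.1.eval x = 0 →
      SignType.sign (P.eval x) = SignType.sign (P'.eval (φ x)))
    (hrd : ∀ x, P.derivative.eval x = 0 →
      SignType.sign (P.eval x) = SignType.sign (P'.eval (φ x))) :
    ∃ ψ : ℝ ≃o ℝ,
      (∀ q ∈ M, ∀ x, SignType.sign (q.1.eval x) = SignType.sign (q.2.eval (ψ x))) ∧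
      ∀ x, SignType.sign (P.eval x) = SignType.sign (P'.eval (ψ x)) := by
  classical
  have hP0 : P ≠ 0 := by rintro rfl; simp at hpos
  have hD0 : P.derivative ≠ 0 := by
    intro h
    have := Polynomial.derivative_eq_zero.1 h
    omega
  have htop : ∀ᶠ x in Filter.atTop,
      SignType.sign (P.eval x) = SignType.sign (P'.eval (φ x)) := by
    filter_upwards [sign_eventually_atTop P,
      φ.tendsto_atTop.eventually (sign_eventually_atTop P')] with x h1 h2
    rw [h1, h2, hlc]
  have hbot : ∀ᶠ x in Filter.atBot,
      SignType.sign (P.eval x) = SignType.sign (P'.eval (φ x)) := by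
    filter_upwards [sign_eventually_atBot P,
      φ.tendsto_atBot.eventually (sign_eventually_atBot P')] with x h1 h2
    rw [h1, h2, sign_mul, sign_mul, hlc, hn]
  obtain ⟨a, ha⟩ := Filter.eventually_atBot.1 hbot
  obtain ⟨b, hb⟩ := Filter.eventually_atTop.1 htop
  set K : Finset ℝ := insert a (insert b
    ((M.bind (fun q : ℝ[X] × ℝ[X] => q.1.roots)).toFinset ∪ P.derivative.roots.toFinset)) with hK
  have hKM : ∀ q ∈ M, q.1.natDegree ≠ 0 → ∀ x, q.1.eval x = 0 → x ∈ K := by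
    intro q hq hq0 x hx
    have : x ∈ M.bind (fun q : ℝ[X] × ℝ[X] => q.1.roots) := by
      rw [Multiset.mem_bind]
      refine ⟨q, hq, ?_⟩
      rw [Polynomial.mem_roots (by rintro h; simp [h] at hq0)]
      exact hx
    simp only [hK, Finset.mem_insert, Finset.mem_union, Multiset.mem_toFinset]
    tauto
  have hKD : ∀ x, P.derivative.eval x = 0 → x ∈ K := by
    intro x hx
    have : x ∈ P.derivative.roots := by rw [Polynomial.mem_roots hD0]; exact hx
    simp only [hK, Finset.mem_insert, Finset.mem_union, Multiset.mem_toFinset]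
    tauto
  have hKs : ∀ x ∈ K, SignType.sign (P.eval x) = SignType.sign (P'.eval (φ x)) := by
    intro x hx
    simp only [hK, Finset.mem_insert, Finset.mem_union, Multiset.mem_toFinset] at hx
    rcases hx with rfl | rfl | hx | hx
    · exact ha _ le_rfl
    · exact hb _ le_rfl
    · rw [Multiset.mem_bind] at hx
      obtain ⟨q, hq, hxs⟩ := hx
      have h1 := Polynomial.mem_roots'.1 hxs
      refine hr q hq ?_ x h1.2
      intro h
      have h2 := Polynomial.eq_C_of_natDegree_eq_zero h
      have h3 := h1.2
      rw [Polynomial.IsRoot, h2, Polynomial.eval_C] at h3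
      exact h1.1 (by rw [h2, h3, Polynomial.C_0])
    · exact hrd x (Polynomial.mem_roots'.1 hx).2
  obtain ⟨τ, hτK, hτ⟩ := core_iso P.roots.toFinset K (fun x => P.eval x) (fun x => P'.eval (φ x))
    P.continuous (P'.continuous.comp φ.continuous) hKs a b (by simp [hK]) (by simp [hK]) ha hb
    (by
      intro x y hxy hfree
      have hne : ∀ t ∈ Ioo x y, P.derivative.eval t ≠ 0 := fun t ht h0 => hfree t (hKD t h0) ht
      obtain ⟨c, hc⟩ := exists_between hxy
      have hsame : ∀ t ∈ Ioo x y, SignType.sign (P.derivative.eval t) =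
          SignType.sign (P.derivative.eval c) := by
        intro t ht
        apply sign_const_of_no_root
        intro r hr
        exact hne r (Set.OrdConnected.uIcc_subset Set.ordConnected_Ioo ht hc hr)
      have hsub : ∀ s ∈ Icc x y, φ s ∈ Icc (φ x) (φ y) := fun s hs =>
        ⟨φ.le_iff_le.2 hs.1, φ.le_iff_le.2 hs.2⟩
      have hsame' : ∀ t ∈ Ioo (φ x) (φ y), SignType.sign (P'.derivative.eval t) =
          SignType.sign (P.derivative.eval c) := by
        intro t ht
        have h1 : φ.symm t ∈ Ioo x y := by
          constructor
          · rw [← φ.lt_iff_lt]; simpa using ht.1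
          · rw [← φ.lt_iff_lt]; simpa using ht.2
        rw [← hsame _ h1, hd]; simp
      rcases lt_or_gt_of_ne (hne c hc) with h | h
      · right
        rw [sign_neg h] at hsame hsame'
        refine ⟨deriv_anti P fun t ht => sign_eq_neg_one_iff.1 (hsame t ht), ?_⟩
        have := deriv_anti P' fun t ht => sign_eq_neg_one_iff.1 (hsame' t ht)
        exact fun s hs t ht hst => this (hsub s hs) (hsub t ht) (φ.lt_iff_lt.2 hst)
      · left
        rw [sign_pos h] at hsame hsame'
        refine ⟨deriv_mono P fun t ht => sign_eq_one_iff.1 (hsame t ht), ?_⟩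
        have := deriv_mono P' fun t ht => sign_eq_one_iff.1 (hsame' t ht)
        exact fun s hs t ht hst => this (hsub s hs) (hsub t ht) (φ.lt_iff_lt.2 hst))
    (by
      intro x hx
      right
      rw [Multiset.mem_toFinset, Polynomial.mem_roots hP0]; exact hx)
  refine ⟨τ.trans φ, ?_, fun x => by simpa using hτ x⟩
  intro q hq x
  rw [OrderIso.trans_apply, ← hM q hq]
  by_cases hq0 : q.1.natDegree = 0
  · rw [Polynomial.eq_C_of_natDegree_eq_zero hq0]; simp
  by_cases hx : x ∈ K
  · rw [hτK x hx]
  apply sign_const_of_no_root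
  intro r hr h0
  have hrK := hKM q hq hq0 r h0
  have hrx := hτK r hrK
  have hne : r ≠ x := by rintro rfl; exact hx hrK
  rw [mem_uIcc] at hr
  rcases hr with ⟨h1, h2⟩ | ⟨h1, h2⟩
  · have := τ.lt_iff_lt.2 (lt_of_le_of_ne h1 hne.symm)
    rw [hrx] at this; linarith
  · have := τ.lt_iff_lt.2 (lt_of_le_of_ne h2 hne)
    rw [hrx] at this; linarith

open Polynomial in
def SignGood {R : Type*} [CommRing R] (L : Multiset R[X]) : Prop :=
  ∃ F : Finset R, ∀ e e' : R →+* ℝ, (∀ a ∈ F, SignType.sign (e a) = SignType.sign (e' a)) →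
    ∃ φ : ℝ ≃o ℝ, ∀ P ∈ L, ∀ x : ℝ,
      SignType.sign ((P.map e).eval x) = SignType.sign ((P.map e').eval (φ x))

lemma sign_cancel {a a' b b' : ℝ} (ha : a ≠ 0) (h1 : SignType.sign a = SignType.sign a')
    (h : SignType.sign (a * b) = SignType.sign (a' * b')) :
    SignType.sign b = SignType.sign b' := by
  rw [sign_mul, sign_mul, ← h1] at h
  exact mul_left_cancel₀ (by simpa using ha) h

open Polynomial in
lemma natDegree_lt_aux {R : Type*} [CommRing R] {r : R[X]} {n : ℕ} (hn : 0 < n)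
    (h1 : r.natDegree ≤ n) (h2 : r.coeff n = 0) : r.natDegree < n := by
  rcases h1.lt_or_eq with h | h
  · exact h
  · rw [← h, Polynomial.coeff_natDegree, Polynomial.leadingCoeff_eq_zero] at h2
    rw [h2] at h; simp at h; omega

open Polynomial in
theorem signGood_all {R : Type*} [CommRing R] (L : Multiset R[X]) : SignGood L := by
  classical
  induction L using (InvImage.wf (fun L : Multiset R[X] => L.map Polynomial.natDegree)
    Multiset.wellFounded_isDershowitzMannaLT).induction with
  | _ L ih =>
  by_cases hall : ∀ q ∈ L, q.natDegree = 0
  · refine ⟨(L.map (fun q => q.coeff 0)).toFinset, fun e e' h => ⟨OrderIso.refl ℝ, ?_⟩⟩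
    intro P hP x
    have h1 := h (P.coeff 0) (by
      rw [Multiset.mem_toFinset]; exact Multiset.mem_map_of_mem (fun q : R[X] => q.coeff 0) hP)
    rw [Polynomial.eq_C_of_natDegree_eq_zero (hall P hP)]
    simpa using h1
  push Not at hall
  obtain ⟨q₀, hq₀, hq₀d⟩ := hall
  obtain ⟨p, hp, hpmax⟩ := L.toFinset.exists_max_image Polynomial.natDegree ⟨q₀, by simpa using hq₀⟩
  rw [Multiset.mem_toFinset] at hp
  have hpmax' : ∀ q ∈ L, q.natDegree ≤ p.natDegree := fun q hq => hpmax q (by simpa using hq)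
  have hn : 0 < p.natDegree := lt_of_lt_of_le (Nat.pos_of_ne_zero hq₀d) (hpmax' q₀ hq₀)
  -- truncations
  have htr : ∀ q : R[X], ∃ F : Finset R, q ∈ L → q.natDegree ≠ 0 → ∀ e e' : R →+* ℝ,
      (∀ a ∈ F, SignType.sign (e a) = SignType.sign (e' a)) →
      ∃ φ : ℝ ≃o ℝ, ∀ P ∈ q.eraseLead ::ₘ L.erase q, ∀ x : ℝ,
      SignType.sign ((P.map e).eval x) = SignType.sign ((P.map e').eval (φ x)) := by
    intro q
    by_cases hq : q ∈ L ∧ q.natDegree ≠ 0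
    · obtain ⟨F, hF⟩ := ih (q.eraseLead ::ₘ L.erase q) (by
        refine ⟨(L.erase q).map natDegree, {q.eraseLead.natDegree}, {q.natDegree}, by simp, ?_, ?_, ?_⟩
        · dsimp only
          rw [Multiset.map_cons, ← Multiset.singleton_add, add_comm]
        · dsimp only
          conv_lhs => rw [← Multiset.cons_erase hq.1]
          rw [Multiset.map_cons, ← Multiset.singleton_add, add_comm]
        · intro y hy
          refine ⟨_, Multiset.mem_singleton_self _, ?_⟩
          rw [Multiset.mem_singleton.1 hy]
          have := q.eraseLead_natDegree_le
          have := hq.2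
          omega)
      exact ⟨F, fun _ _ => hF⟩
    · exact ⟨∅, fun h1 h2 => absurd ⟨h1, h2⟩ hq⟩
  choose G hG using htr
  obtain ⟨M, rfl⟩ := Multiset.exists_cons_of_mem hp
  set r : R[X] → R[X] := fun q => Polynomial.C q.leadingCoeff * p -
    Polynomial.C p.leadingCoeff * Polynomial.X ^ (p.natDegree - q.natDegree) * q with hrdef
  have hrdeg : ∀ q ∈ M, (r q).natDegree < p.natDegree := by
    intro q hq
    have hle := hpmax' q (Multiset.mem_cons_of_mem hq)
    apply natDegree_lt_aux hn
    · refine (Polynomial.natDegree_sub_le _ _).trans (max_le (Polynomial.natDegree_C_mul_le _ _) ?_)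
      refine Polynomial.natDegree_mul_le.trans ?_
      have := Polynomial.natDegree_C_mul_X_pow_le p.leadingCoeff (p.natDegree - q.natDegree)
      omega
    · have : p.natDegree = q.natDegree + (p.natDegree - q.natDegree) := by omega
      simp only [hrdef]
      rw [Polynomial.coeff_sub, Polynomial.coeff_C_mul, mul_assoc, Polynomial.coeff_C_mul]
      conv_lhs => rw [mul_comm (Polynomial.X ^ _) q]
      have h2 : (q * Polynomial.X ^ (p.natDegree - q.natDegree)).coeff p.natDegree
          = q.leadingCoeff := by
        conv_lhs => rw [this]
        rw [show q.natDegree + (p.natDegree - q.natDegree) - q.natDegree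
          = p.natDegree - q.natDegree by omega]
        rw [Polynomial.coeff_mul_X_pow]; rfl
      rw [h2, Polynomial.coeff_natDegree]; ring
  set rd : R[X] := Polynomial.C (p.natDegree : R) * p - Polynomial.X * derivative p with hrddef
  have hddeg : (derivative p).natDegree < p.natDegree := Polynomial.natDegree_derivative_lt hn.ne'
  have hrddeg : rd.natDegree < p.natDegree := by
    apply natDegree_lt_aux hn
    · refine (Polynomial.natDegree_sub_le _ _).trans (max_le (Polynomial.natDegree_C_mul_le _ _) ?_)
      refine Polynomial.natDegree_mul_le.trans ?_
      have := Polynomial.natDegree_X_le (R := R)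
      omega
    · obtain ⟨k, hk⟩ : ∃ k, p.natDegree = k + 1 := ⟨p.natDegree - 1, by omega⟩
      simp only [hrddef]
      rw [Polynomial.coeff_sub, Polynomial.coeff_C_mul, hk, Polynomial.coeff_X_mul, Polynomial.coeff_derivative]
      push_cast; ring
  obtain ⟨F', hF'⟩ := ih (M + (derivative p ::ₘ rd ::ₘ M.map r)) (by
    refine ⟨M.map natDegree, (derivative p ::ₘ rd ::ₘ M.map r).map natDegree, {p.natDegree},
      by simp, by simp [Multiset.map_add], ?_, ?_⟩
    · dsimp only
      rw [Multiset.map_cons, ← Multiset.singleton_add, add_comm]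
    · intro y hy
      refine ⟨_, Multiset.mem_singleton_self _, ?_⟩
      obtain ⟨s, hs, rfl⟩ := Multiset.mem_map.1 hy
      rw [Multiset.mem_cons, Multiset.mem_cons, Multiset.mem_map] at hs
      rcases hs with rfl | rfl | ⟨q, hq, rfl⟩
      · exact hddeg
      · exact hrddeg
      · exact hrdeg q hq)
  refine ⟨F' ∪ (p ::ₘ M).toFinset.image leadingCoeff ∪ (p ::ₘ M).toFinset.biUnion G, ?_⟩
  intro e e' hee
  have hF : ∀ a ∈ F', SignType.sign (e a) = SignType.sign (e' a) := fun a ha =>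
    hee a (by simp [ha])
  have hlc : ∀ q ∈ p ::ₘ M, SignType.sign (e q.leadingCoeff) = SignType.sign (e' q.leadingCoeff) := by
    intro q hq
    apply hee
    apply Finset.mem_union_left
    apply Finset.mem_union_right
    exact Finset.mem_image_of_mem _ (by simpa using hq)
  by_cases hz : ∃ q ∈ p ::ₘ M, q.natDegree ≠ 0 ∧ e q.leadingCoeff = 0
  · obtain ⟨q, hq, hqd, hqe⟩ := hz
    have hqe' : e' q.leadingCoeff = 0 := by
      have := hlc q hq
      rw [hqe, sign_zero] at this
      exact sign_eq_zero_iff.1 this.symm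
    obtain ⟨φ, hφ⟩ := hG q hq hqd e e' (fun a ha => hee a (by
      apply Finset.mem_union_right
      exact Finset.mem_biUnion.2 ⟨q, by simpa using hq, ha⟩))
    have hmap : ∀ e : R →+* ℝ, e q.leadingCoeff = 0 → q.map e = q.eraseLead.map e := by
      intro e he
      conv_lhs => rw [← q.eraseLead_add_monomial_natDegree_leadingCoeff]
      rw [Polynomial.map_add, Polynomial.map_monomial, he]; simp
    refine ⟨φ, fun P hP x => ?_⟩
    by_cases hPq : P = q
    · subst hPq
      rw [hmap e hqe, hmap e' hqe']
      exact hφ _ (Multiset.mem_cons_self _ _) x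
    · exact hφ P (Multiset.mem_cons_of_mem ((Multiset.mem_erase_of_ne hPq).2 hP)) x
  · push Not at hz
    obtain ⟨φ, hφ⟩ := hF' e e' hF
    have hpL : p ∈ p ::ₘ M := Multiset.mem_cons_self _ _
    have hpe : e p.leadingCoeff ≠ 0 := hz p hpL hn.ne'
    have hpe' : e' p.leadingCoeff ≠ 0 := by
      intro h
      have := hlc p hpL
      rw [h, sign_zero] at this
      exact hpe (sign_eq_zero_iff.1 this)
    have hdm : ∀ x, SignType.sign ((derivative (p.map e)).eval x) =
        SignType.sign ((derivative (p.map e')).eval (φ x)) := by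
      intro x
      rw [Polynomial.derivative_map, Polynomial.derivative_map]
      exact hφ (derivative p) (by simp) x
    obtain ⟨ψ, hψ1, hψ2⟩ := step_iso (M.map (fun q => (q.map e, q.map e'))) (p.map e) (p.map e')
      (by rw [Polynomial.natDegree_map_of_leadingCoeff_ne_zero _ hpe, Polynomial.natDegree_map_of_leadingCoeff_ne_zero _ hpe'])
      (by rw [Polynomial.natDegree_map_of_leadingCoeff_ne_zero _ hpe]; exact hn)
      (by rw [Polynomial.leadingCoeff_map_of_leadingCoeff_ne_zero _ hpe,
            Polynomial.leadingCoeff_map_of_leadingCoeff_ne_zero _ hpe']; exact hlc p hpL)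
      φ
      (by
        intro q hq x
        obtain ⟨s, hs, rfl⟩ := Multiset.mem_map.1 hq
        exact hφ s (Multiset.mem_add.2 (Or.inl hs)) x)
      hdm
      (by
        intro q hq hqd x hx
        obtain ⟨s, hs, rfl⟩ := Multiset.mem_map.1 hq
        dsimp only at hqd hx
        have hsL : s ∈ p ::ₘ M := Multiset.mem_cons_of_mem hs
        have hsd : s.natDegree ≠ 0 := by
          intro h
          have := Polynomial.natDegree_map_le (p := s) (f := e)
          omega
        have hx' : (s.map e').eval (φ x) = 0 := by
          have := hφ s (Multiset.mem_add.2 (Or.inl hs)) x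
          rw [hx, sign_zero] at this
          exact sign_eq_zero_iff.1 this.symm
        have h1 := hφ (r s) (by
          apply Multiset.mem_add.2; right
          apply Multiset.mem_cons_of_mem
          apply Multiset.mem_cons_of_mem
          exact Multiset.mem_map_of_mem r hs) x
        simp only [hrdef, Polynomial.map_sub, Polynomial.map_mul, Polynomial.map_C, Polynomial.eval_sub,
          Polynomial.eval_mul, Polynomial.eval_C, hx, hx', mul_zero, sub_zero] at h1
        exact sign_cancel (hz s hsL hsd) (hlc s hsL) h1)
      (by
        intro x hx
        have hx' : (derivative (p.map e')).eval (φ x) = 0 := by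
          have := hdm x
          rw [hx, sign_zero] at this
          exact sign_eq_zero_iff.1 this.symm
        have h1 := hφ rd (by simp) x
        rw [Polynomial.derivative_map] at hx hx'
        simp only [hrddef, Polynomial.map_sub, Polynomial.map_mul, Polynomial.map_natCast, Polynomial.eval_sub,
          Polynomial.eval_mul, Polynomial.eval_natCast, hx, hx', mul_zero, sub_zero, map_natCast] at h1
        exact sign_cancel (a := (p.natDegree : ℝ)) (by exact_mod_cast hn.ne') rfl h1)
    refine ⟨ψ, fun P hP x => ?_⟩
    rcases Multiset.mem_cons.1 hP with rfl | hP
    · exact hψ2 x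
    · exact hψ1 _ (Multiset.mem_map_of_mem (fun q : R[X] => (q.map e, q.map e')) hP) x

theorem sign_elim (n : ℕ) : ∀ {R : Type} [CommRing R] (G : Finset (MvPolynomial (Fin n) R)),
    ∃ F : Finset R, ∀ e e' : R →+* ℝ, (∀ a ∈ F, SignType.sign (e a) = SignType.sign (e' a)) →
    ∀ x : Fin n → ℝ, ∃ x' : Fin n → ℝ, ∀ g ∈ G,
      SignType.sign (MvPolynomial.eval₂ e x g) = SignType.sign (MvPolynomial.eval₂ e' x' g) := by
  classical
  induction n with
  | zero =>
    intro R _ G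
    refine ⟨G.image (MvPolynomial.coeff 0), fun e e' h x => ⟨x, fun g hg => ?_⟩⟩
    have h1 := h _ (Finset.mem_image_of_mem _ hg)
    rw [MvPolynomial.eq_C_of_isEmpty g]
    simpa using h1
  | succ n ih =>
    intro R _ G
    obtain ⟨F₁, hF₁⟩ := signGood_all (G.val.map (fun g => MvPolynomial.finSuccEquiv R n g))
    obtain ⟨F, hF⟩ := ih F₁
    refine ⟨F, fun e e' h x => ?_⟩
    obtain ⟨y, hy⟩ := hF e e' h (fun i => x i.succ)
    obtain ⟨φ, hφ⟩ := hF₁ (MvPolynomial.eval₂Hom e (fun i => x i.succ))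
      (MvPolynomial.eval₂Hom e' y) hy
    have key : ∀ (e : R →+* ℝ) (t : ℝ) (y : Fin n → ℝ) (g : MvPolynomial (Fin (n+1)) R),
        MvPolynomial.eval₂ e (Fin.cons t y : Fin (n+1) → ℝ) g =
        ((MvPolynomial.finSuccEquiv R n g).map (MvPolynomial.eval₂Hom e y)).eval t := by
      intro e t y g
      rw [Polynomial.eval_map]
      have : MvPolynomial.eval₂Hom e (Fin.cons t y : Fin (n+1) → ℝ) =
        (Polynomial.eval₂RingHom (MvPolynomial.eval₂Hom e y) t).comp
          (MvPolynomial.finSuccEquiv R n : MvPolynomial (Fin (n+1)) R →+* _) := by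
        apply MvPolynomial.ringHom_ext
        · intro a; simp [MvPolynomial.finSuccEquiv_apply]
        · intro i
          refine Fin.cases ?_ (fun i => ?_) i
          · simp [MvPolynomial.finSuccEquiv_apply]
          · simp [MvPolynomial.finSuccEquiv_apply]
      exact RingHom.congr_fun this g
    refine ⟨Fin.cons (φ (x 0)) y, fun g hg => ?_⟩
    have h1 := hφ _ (Multiset.mem_map_of_mem (fun g => MvPolynomial.finSuccEquiv R n g) hg) (x 0)
    rw [key]
    rw [← h1, ← key]
    congr 2
    exact (Fin.cons_self_tail x).symm

noncomputable def evRM (r m : ℝ) : Polynomial (Polynomial ℝ) →+* ℝ :=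
  Polynomial.eval₂RingHom (Polynomial.evalRingHom r) m

lemma evRM_C (r m : ℝ) (a : Polynomial ℝ) : evRM r m (Polynomial.C a) = a.eval r := by
  simp [evRM]

lemma evRM_X (r m : ℝ) : evRM r m Polynomial.X = m := by
  simp [evRM]

lemma poly_bound_s11 (a : Polynomial ℝ) : ∃ (H : ℝ) (K : ℕ), 0 ≤ H ∧ ∀ r : ℝ, 1 ≤ r →
    |a.eval r| ≤ H * r ^ K := by
  induction a using Polynomial.induction_on' with
  | add p q hp hq =>
    obtain ⟨H1, K1, h1, h1'⟩ := hp
    obtain ⟨H2, K2, h2, h2'⟩ := hq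
    refine ⟨H1 + H2, max K1 K2, by positivity, fun r hr => ?_⟩
    have e1 : r ^ K1 ≤ r ^ max K1 K2 := pow_le_pow_right₀ hr (le_max_left _ _)
    have e2 : r ^ K2 ≤ r ^ max K1 K2 := pow_le_pow_right₀ hr (le_max_right _ _)
    rw [Polynomial.eval_add]
    have := abs_add_le (p.eval r) (q.eval r)
    have := h1' r hr
    have := h2' r hr
    nlinarith [mul_le_mul_of_nonneg_left e1 h1, mul_le_mul_of_nonneg_left e2 h2]
  | monomial k c =>
    refine ⟨|c|, k, abs_nonneg _, fun r hr => ?_⟩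
    rw [Polynomial.eval_monomial, abs_mul, abs_of_nonneg (by positivity : 0 ≤ r ^ k)]

lemma evRM_bound (g : Polynomial (Polynomial ℝ)) : ∃ (H : ℝ) (K : ℕ), 0 ≤ H ∧ ∀ r m : ℝ, 1 ≤ r →
    0 < m → m ≤ 1 → |evRM r m g| ≤ H * r ^ K := by
  induction g using Polynomial.induction_on' with
  | add p q hp hq =>
    obtain ⟨H1, K1, h1, h1'⟩ := hp
    obtain ⟨H2, K2, h2, h2'⟩ := hq
    refine ⟨H1 + H2, max K1 K2, by positivity, fun r m hr hm hm' => ?_⟩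
    have e1 : r ^ K1 ≤ r ^ max K1 K2 := pow_le_pow_right₀ hr (le_max_left _ _)
    have e2 : r ^ K2 ≤ r ^ max K1 K2 := pow_le_pow_right₀ hr (le_max_right _ _)
    rw [map_add]
    have := abs_add_le (evRM r m p) (evRM r m q)
    have := h1' r m hr hm hm'
    have := h2' r m hr hm hm'
    nlinarith [mul_le_mul_of_nonneg_left e1 h1, mul_le_mul_of_nonneg_left e2 h2]
  | monomial k c =>
    obtain ⟨H, K, h1, h1'⟩ := poly_bound_s11 c
    refine ⟨H, K, h1, fun r m hr hm hm' => ?_⟩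
    rw [← Polynomial.C_mul_X_pow_eq_monomial, map_mul, map_pow, evRM_C, evRM_X, abs_mul,
      abs_of_nonneg (by positivity : 0 ≤ m ^ k)]
    have : m ^ k ≤ 1 := pow_le_one₀ hm.le hm'
    calc _ ≤ |c.eval r| * 1 := by gcongr
      _ ≤ _ := by rw [mul_one]; exact h1' r hr

lemma poly_lower_s11 (a : Polynomial ℝ) (ha : a ≠ 0) : ∃ c > 0, ∀ᶠ r in Filter.atTop, c ≤ |a.eval r| := by
  by_cases h : a.natDegree = 0
  · refine ⟨|a.coeff 0|, ?_, ?_⟩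
    · refine abs_pos.2 ?_
      intro h0
      rw [Polynomial.eq_C_of_natDegree_eq_zero h, h0] at ha; simp at ha
    · filter_upwards with r
      conv_rhs => rw [Polynomial.eq_C_of_natDegree_eq_zero h]
      simp
  · refine ⟨1, one_pos, ?_⟩
    exact (a.abs_tendsto_atTop
      (Polynomial.natDegree_pos_iff_degree_pos.1 (Nat.pos_of_ne_zero h))).eventually_ge_atTop 1

lemma sign_add_small {a b : ℝ} (h : |b| < |a|) : SignType.sign (a + b) = SignType.sign a := by
  rcases lt_trichotomy a 0 with h1 | h1 | h1
  · rw [abs_of_neg h1] at h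
    have := le_abs_self b
    rw [sign_neg h1, sign_neg (by linarith)]
  · rw [h1] at h; simp at h; linarith [abs_nonneg b]
  · rw [abs_of_pos h1] at h
    have := neg_abs_le b
    rw [sign_pos h1, sign_pos (by linarith)]

lemma growth_one (k : ℕ) : ∀ g : Polynomial (Polynomial ℝ), g.natDegree ≤ k → ∃ N : ℕ,
    ∀ᶠ r in Filter.atTop, ∀ m m' : ℝ, 0 < m → m * r ^ N < 1 → 0 < m' → m' * r ^ N < 1 →
      SignType.sign (evRM r m g) = SignType.sign (evRM r m' g) := by
  induction k with
  | zero =>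
    intro g hg
    refine ⟨0, Filter.Eventually.of_forall fun r m m' _ _ _ _ => ?_⟩
    rw [Polynomial.eq_C_of_natDegree_le_zero hg, evRM_C, evRM_C]
  | succ k ih =>
    intro g hg
    have hdec : ∀ r m, evRM r m g = (g.coeff 0).eval r + m * evRM r m g.divX := by
      intro r m
      conv_lhs => rw [← Polynomial.X_mul_divX_add g]
      rw [map_add, map_mul, evRM_X, evRM_C, add_comm]
    by_cases h0 : g.coeff 0 = 0
    · obtain ⟨N, hN⟩ := ih g.divX (by rw [Polynomial.natDegree_divX_eq_natDegree_tsub_one]; omega)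
      refine ⟨N, ?_⟩
      filter_upwards [hN] with r hr m m' h1 h2 h3 h4
      rw [hdec, hdec, h0]
      simp only [Polynomial.eval_zero, zero_add]
      rw [sign_mul, sign_mul, sign_pos h1, sign_pos h3, hr m m' h1 h2 h3 h4]
    · obtain ⟨c, hc, hc'⟩ := poly_lower_s11 _ h0
      obtain ⟨H, K, hH, hH'⟩ := evRM_bound g.divX
      refine ⟨K + 1, ?_⟩
      filter_upwards [hc', Filter.eventually_ge_atTop 1, Filter.eventually_ge_atTop (H / c)]
        with r h1 h2 h3
      have main : ∀ m, 0 < m → m * r ^ (K + 1) < 1 →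
          SignType.sign (evRM r m g) = SignType.sign ((g.coeff 0).eval r) := by
        intro m hm hm'
        rw [hdec]
        apply sign_add_small
        have hr1 : 1 ≤ r ^ (K+1) := one_le_pow₀ h2
        have hm1 : m ≤ 1 := by nlinarith
        have hb := hH' r m h2 hm hm1
        rw [div_le_iff₀ hc] at h3
        rw [abs_mul, abs_of_pos hm]
        have hr0 : 0 < r := by linarith
        have hrK : 0 < r ^ K := by positivity
        rw [pow_succ] at hm'
        have e1 : m * |evRM r m g.divX| ≤ m * (H * r ^ K) := mul_le_mul_of_nonneg_left hb hm.le
        have e2 : m * (H * r ^ K) ≤ m * (r * c * r ^ K) := by gcongr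
        have e3 : m * (r * c * r ^ K) = c * (m * (r ^ K * r)) := by ring
        have e4 : c * (m * (r ^ K * r)) < c * 1 := mul_lt_mul_of_pos_left hm' hc
        linarith
      intro m m' a1 a2 a3 a4
      rw [main m a1 a2, main m' a3 a4]

lemma growth_fin (F : Finset (Polynomial (Polynomial ℝ))) : ∃ N : ℕ,
    ∀ᶠ r in Filter.atTop, ∀ m m' : ℝ, 0 < m → m * r ^ N < 1 → 0 < m' → m' * r ^ N < 1 →
      ∀ g ∈ F, SignType.sign (evRM r m g) = SignType.sign (evRM r m' g) := by
  classical
  induction F using Finset.induction_on with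
  | empty => exact ⟨0, by simp⟩
  | insert g F _ ih =>
    obtain ⟨N1, h1⟩ := ih
    obtain ⟨N2, h2⟩ := growth_one _ g le_rfl
    refine ⟨max N1 N2, ?_⟩
    filter_upwards [h1, h2, Filter.eventually_ge_atTop 1] with r h1 h2 hr m m' a1 a2 a3 a4 f hf
    have e1 : r ^ N1 ≤ r ^ max N1 N2 := pow_le_pow_right₀ hr (le_max_left _ _)
    have e2 : r ^ N2 ≤ r ^ max N1 N2 := pow_le_pow_right₀ hr (le_max_right _ _)
    rcases Finset.mem_insert.1 hf with rfl | hf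
    · exact h2 m m' a1 (by nlinarith) a3 (by nlinarith)
    · exact h1 m m' a1 (by nlinarith) a3 (by nlinarith) f hf

lemma loj_compact_s11 {n : ℕ} (S : Set (Fin n → ℝ)) (h p : MvPolynomial (Fin n) ℝ)
    (hh : ∀ x ∈ S, 0 < MvPolynomial.eval x h)
    (hcl : ∀ x ∈ closure S, MvPolynomial.eval x h ≠ 0 → x ∈ S)
    (hp : ∀ x ∈ S, MvPolynomial.eval x p ≠ 0) (r : ℝ) :
    ∃ μ > 0, ∀ x ∈ S, 1 ≤ MvPolynomial.eval x h * (r - 1 - ∑ i, x i ^ 2) →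
      μ ≤ (MvPolynomial.eval x p) ^ 2 := by
  set A : Set (Fin n → ℝ) := {x | x ∈ closure S ∧ 0 ≤ MvPolynomial.eval x h ∧
    1 ≤ MvPolynomial.eval x h * (r - 1 - ∑ i, x i ^ 2)} with hA
  have hch : Continuous fun x : Fin n → ℝ => MvPolynomial.eval x h := MvPolynomial.continuous_eval h
  have hcp : Continuous fun x : Fin n → ℝ => MvPolynomial.eval x p := MvPolynomial.continuous_eval p
  have hclosed : IsClosed A := by
    have hc2 : Continuous fun x : Fin n → ℝ =>
        MvPolynomial.eval x h * (r - 1 - ∑ i, x i ^ 2) := by fun_prop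
    have hA' : A = closure S ∩ ({x | 0 ≤ MvPolynomial.eval x h} ∩
        {x | 1 ≤ MvPolynomial.eval x h * (r - 1 - ∑ i, x i ^ 2)}) := rfl
    rw [hA']
    exact isClosed_closure.inter ((isClosed_le continuous_const hch).inter
      (isClosed_le continuous_const hc2))
  have hAS : A ⊆ S := by
    rintro x ⟨h1, h2, h3⟩
    refine hcl x h1 ?_
    intro h0; rw [h0] at h3; norm_num at h3
  have hbdd : A ⊆ Metric.closedBall 0 |r| := by
    rintro x ⟨h1, h2, h3⟩
    rw [mem_closedBall_zero_iff, pi_norm_le_iff_of_nonneg (abs_nonneg r)]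
    intro i
    have hs : 0 < r - 1 - ∑ i, x i ^ 2 := by
      by_contra hneg
      push Not at hneg
      nlinarith [mul_nonneg h2 (neg_nonneg.2 hneg)]
    have hi : x i ^ 2 ≤ ∑ i, x i ^ 2 :=
      Finset.single_le_sum (f := fun i => x i ^ 2) (fun j _ => sq_nonneg _) (Finset.mem_univ i)
    have hr : 0 ≤ r := by nlinarith [sq_nonneg (x i)]
    rw [Real.norm_eq_abs, abs_of_nonneg hr, abs_le]
    constructor <;> nlinarith [sq_nonneg (x i - 1), sq_nonneg (x i + 1)]
  have hcomp : IsCompact A := (isCompact_closedBall 0 |r|).of_isClosed_subset hclosed hbdd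
  have hmem : ∀ x ∈ S, 1 ≤ MvPolynomial.eval x h * (r - 1 - ∑ i, x i ^ 2) → x ∈ A :=
    fun x hx h1 => ⟨subset_closure hx, (hh x hx).le, h1⟩
  rcases A.eq_empty_or_nonempty with he | hne
  · refine ⟨1, one_pos, fun x hx h1 => ?_⟩
    have := hmem x hx h1
    rw [he] at this; exact this.elim
  · obtain ⟨y, hy, hmin⟩ := hcomp.exists_isMinOn hne (hcp.pow 2).continuousOn
    have := hp y (hAS hy)
    exact ⟨(MvPolynomial.eval y p) ^ 2, by positivity, fun x hx h1 => hmin (hmem x hx h1)⟩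

theorem loj {n : ℕ} (G : Finset (MvPolynomial (Fin n) ℝ)) (S : Set (Fin n → ℝ))
    (hS : ∀ x y, (∀ g ∈ G, SignType.sign (MvPolynomial.eval x g) =
      SignType.sign (MvPolynomial.eval y g)) → x ∈ S → y ∈ S)
    (h p : MvPolynomial (Fin n) ℝ)
    (hh : ∀ x ∈ S, 0 < MvPolynomial.eval x h)
    (hcl : ∀ x ∈ closure S, MvPolynomial.eval x h ≠ 0 → x ∈ S)
    (hp : ∀ x ∈ S, MvPolynomial.eval x p ≠ 0) :
    ∃ (N : ℕ) (c : ℝ), 0 < c ∧ ∀ x ∈ S, (MvPolynomial.eval x h) ^ N ≤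
      c * (((1 + ∑ i, x i ^ 2) * MvPolynomial.eval x h + 1) ^ N * (MvPolynomial.eval x p) ^ 2) := by
  classical
  set ι : ℝ →+* Polynomial (Polynomial ℝ) := Polynomial.C.comp Polynomial.C with hι
  have hιe : ∀ r m, (evRM r m).comp ι = RingHom.id ℝ := by
    intro r m; ext a; simp [hι, evRM_C]
  have hev : ∀ r m (x : Fin n → ℝ) (g : MvPolynomial (Fin n) ℝ),
      MvPolynomial.eval₂ (evRM r m) x (MvPolynomial.map ι g) = MvPolynomial.eval x g := by
    intro r m x g
    rw [MvPolynomial.eval₂_map, hιe]; rfl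
  set g1 : MvPolynomial (Fin n) (Polynomial (Polynomial ℝ)) :=
    MvPolynomial.map ι h * (MvPolynomial.C (Polynomial.C (Polynomial.X : Polynomial ℝ)) - 1
      - ∑ i, MvPolynomial.X i ^ 2) - 1 with hg1
  set g2 : MvPolynomial (Fin n) (Polynomial (Polynomial ℝ)) :=
    MvPolynomial.map ι p ^ 2 - MvPolynomial.C Polynomial.X with hg2
  have hg1e : ∀ r m x, MvPolynomial.eval₂ (evRM r m) x g1 =
      MvPolynomial.eval x h * (r - 1 - ∑ i, x i ^ 2) - 1 := by
    intro r m x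
    rw [← hev r m x h]
    simp only [← MvPolynomial.coe_eval₂Hom, hg1, map_sub, map_mul, map_one, map_sum, map_pow]
    simp [evRM_C]
  have hg2e : ∀ r m x, MvPolynomial.eval₂ (evRM r m) x g2 = MvPolynomial.eval x p ^ 2 - m := by
    intro r m x
    rw [← hev r m x p]
    simp only [← MvPolynomial.coe_eval₂Hom, hg2, map_sub, map_pow]
    simp [evRM_X]
  obtain ⟨F, hF⟩ := sign_elim n (insert g1 (insert g2 (G.image (MvPolynomial.map ι))))
  obtain ⟨N, hN⟩ := growth_fin F
  obtain ⟨r0, hr0⟩ := Filter.eventually_atTop.1 hN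
  obtain ⟨μ0, hμ0, hμ0'⟩ := loj_compact_s11 S h p hh hcl hp r0
  have claim : ∀ x ∈ S, ∀ r, r0 ≤ r → MvPolynomial.eval x h * (r - 1 - ∑ i, x i ^ 2) = 1 →
      1 ≤ MvPolynomial.eval x p ^ 2 * r ^ N := by
    intro x hx r hr hrx
    by_contra hlt
    push Not at hlt
    have hpx : 0 < MvPolynomial.eval x p ^ 2 := by have := hp x hx; positivity
    obtain ⟨μ, hμ, hμ'⟩ := loj_compact_s11 S h p hh hcl hp r
    have hμx := hμ' x hx hrx.ge
    have hrpos : 0 ≤ r := by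
      have h1 := hh x hx
      have h2 : 0 < r - 1 - ∑ i, x i ^ 2 := by
        by_contra hneg
        push Not at hneg
        nlinarith [mul_nonneg h1.le (neg_nonneg.2 hneg)]
      have h3 : 0 ≤ ∑ i, x i ^ 2 := Finset.sum_nonneg fun i _ => sq_nonneg _
      linarith
    have hrN : 0 ≤ r ^ N := by positivity
    obtain ⟨x', hx'⟩ := hF (evRM r (MvPolynomial.eval x p ^ 2)) (evRM r (μ / 2))
      (fun a ha => hr0 r hr _ _ hpx hlt (by positivity) (by nlinarith) a ha) x
    have hx'S : x' ∈ S := by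
      refine hS x x' (fun g hg => ?_) hx
      have := hx' (MvPolynomial.map ι g) (by
        apply Finset.mem_insert_of_mem
        apply Finset.mem_insert_of_mem
        exact Finset.mem_image_of_mem _ hg)
      rwa [hev, hev] at this
    have e1 := hx' g1 (by simp)
    rw [hg1e, hg1e, hrx, sub_self, sign_zero] at e1
    have e1' := sign_eq_zero_iff.1 e1.symm
    have e2 := hx' g2 (by simp)
    rw [hg2e, hg2e, sub_self, sign_zero] at e2
    have e2' := sign_eq_zero_iff.1 e2.symm
    have := hμ' x' hx'S (by linarith)
    linarith
  refine ⟨N, 1 + 1 / μ0, by positivity, fun x hx => ?_⟩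
  have hhx := hh x hx
  set s := ∑ i, x i ^ 2 with hs
  have hs0 : 0 ≤ s := Finset.sum_nonneg fun i _ => sq_nonneg _
  set H := MvPolynomial.eval x h with hH
  set r := 1 + s + 1 / H with hrdef
  have hHr : H * r = (1 + s) * H + 1 := by rw [hrdef]; field_simp
  have hr1 : 1 ≤ r := by
    have : 0 < 1 / H := by positivity
    linarith
  have hHr' : H * (r - 1 - s) = 1 := by rw [hrdef]; field_simp; ring
  have hrN1 : 1 ≤ r ^ N := one_le_pow₀ hr1
  have key : 1 ≤ (1 + 1 / μ0) * (r ^ N * MvPolynomial.eval x p ^ 2) := by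
    have hpos : 0 ≤ r ^ N * MvPolynomial.eval x p ^ 2 := by positivity
    by_cases hr : r0 ≤ r
    · have := claim x hx r hr hHr'
      have h2 : 0 ≤ 1 / μ0 * (r ^ N * MvPolynomial.eval x p ^ 2) := by positivity
      nlinarith
    · push Not at hr
      have h3 := hμ0' x hx (by
        rw [← hHr']
        apply mul_le_mul_of_nonneg_left _ hhx.le
        linarith)
      have h4 : μ0 ≤ r ^ N * MvPolynomial.eval x p ^ 2 := by nlinarith
      have h5 : 1 / μ0 * μ0 = 1 := by field_simp
      have h6 : 1 / μ0 * μ0 ≤ 1 / μ0 * (r ^ N * MvPolynomial.eval x p ^ 2) := by gcongr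
      nlinarith
  rw [← hHr, mul_pow]
  calc H ^ N = H ^ N * 1 := (mul_one _).symm
    _ ≤ H ^ N * ((1 + 1 / μ0) * (r ^ N * MvPolynomial.eval x p ^ 2)) := by gcongr
    _ = _ := by ring


lemma coeff_quot (k : ℕ) : ∀ (A Q : Polynomial ℝ) (G : ℝ → ℝ), Continuous G →
    (∀ t, A.eval t = G t * Q.eval t) → (∀ j < k, Q.coeff j = 0) →
    A.coeff k = G 0 * Q.coeff k := by
  induction k with
  | zero =>
    intro A Q G _ h _
    rw [Polynomial.coeff_zero_eq_eval_zero, Polynomial.coeff_zero_eq_eval_zero, h]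
  | succ k ih =>
    intro A Q G hG h hj
    have hQ0 : Q.coeff 0 = 0 := hj 0 (Nat.succ_pos k)
    have hA0 : A.coeff 0 = 0 := by
      rw [Polynomial.coeff_zero_eq_eval_zero, h, ← Polynomial.coeff_zero_eq_eval_zero, hQ0, mul_zero]
    have hA : ∀ t, A.eval t = t * A.divX.eval t := by
      intro t
      conv_lhs => rw [← Polynomial.X_mul_divX_add A, hA0]
      simp
    have hQ : ∀ t, Q.eval t = t * Q.divX.eval t := by
      intro t
      conv_lhs => rw [← Polynomial.X_mul_divX_add Q, hQ0]
      simp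
    have key : (fun t => A.divX.eval t) = fun t => G t * Q.divX.eval t := by
      refine Continuous.ext_on (dense_compl_singleton (0 : ℝ)) A.divX.continuous
        (hG.mul Q.divX.continuous) ?_
      intro t ht
      have ht0 : t ≠ 0 := ht
      apply mul_left_cancel₀ ht0
      have := h t
      rw [hA, hQ] at this
      rw [this]; ring
    have := ih A.divX Q.divX G hG (fun t => congrFun key t) (fun j hjk => by
      rw [Polynomial.coeff_divX]; exact hj (j + 1) (by omega))
    rwa [Polynomial.coeff_divX, Polynomial.coeff_divX] at this

noncomputable def lineP {n : ℕ} (u : Fin n → ℝ) (q : MvPolynomial (Fin n) ℝ) :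
    Polynomial (MvPolynomial (Fin n) ℝ) :=
  MvPolynomial.eval₂ ((Polynomial.C).comp MvPolynomial.C)
    (fun i => Polynomial.C (MvPolynomial.X i) + Polynomial.X * Polynomial.C (MvPolynomial.C (u i))) q

lemma lineP_eval {n : ℕ} (u v : Fin n → ℝ) (t : ℝ) (q : MvPolynomial (Fin n) ℝ) :
    ((lineP u q).map (MvPolynomial.eval v)).eval t
      = MvPolynomial.eval (fun i => v i + t * u i) q := by
  induction q using MvPolynomial.induction_on with
  | C a => simp [lineP]
  | add p q hp hq =>
    simp only [lineP, MvPolynomial.eval₂_add, Polynomial.map_add, Polynomial.eval_add, map_add] at *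
    rw [hp, hq]
  | mul_X p i hp =>
    simp only [lineP, MvPolynomial.eval₂_mul, Polynomial.map_mul, Polynomial.eval_mul, map_mul,
      MvPolynomial.eval₂_X] at *
    rw [hp]
    simp
    left; ring

lemma regulous_global {n : ℕ} (g : (Fin n → ℝ) → ℝ) (hg : IsRegulous g) :
    ∃ (p q : MvPolynomial (Fin n) ℝ) (u : Fin n → ℝ), MvPolynomial.eval u q ≠ 0 ∧
      ∀ x, g x * MvPolynomial.eval x q = MvPolynomial.eval x p := by
  obtain ⟨hc, U, ⟨_, k, e, he⟩, ⟨u, hu⟩, p, q, hq, hpq⟩ := hg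
  refine ⟨p, q, u, hq u hu, fun x => ?_⟩
  have hu' : ¬ ∀ i, MvPolynomial.eval u (e i) = 0 := by
    intro h
    have : u ∈ Set.univ \ U := by rw [he]; exact h
    exact this.2 hu
  push Not at hu'
  obtain ⟨i, hi⟩ := hu'
  set R : Polynomial ℝ := (lineP (fun j => u j - x j) (e i)).map (MvPolynomial.eval x) with hR
  have hR0 : R ≠ 0 := by
    intro h0
    have := lineP_eval (fun j => u j - x j) x 1 (e i)
    rw [← hR, h0] at this
    simp at this
    exact hi this.symm
  have hfin : {t : ℝ | R.IsRoot t}.Finite := Polynomial.finite_setOf_isRoot hR0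
  have hdense : Dense (Set.univ \ {t : ℝ | R.IsRoot t}) := dense_univ.diff_finite hfin
  have hl : Continuous fun t : ℝ => (fun j => x j + t * (u j - x j)) := by fun_prop
  have key : (fun t : ℝ => g (fun j => x j + t * (u j - x j)) *
      MvPolynomial.eval (fun j => x j + t * (u j - x j)) q) =
      fun t : ℝ => MvPolynomial.eval (fun j => x j + t * (u j - x j)) p := by
    refine Continuous.ext_on hdense ((hc.comp hl).mul ((MvPolynomial.continuous_eval q).comp hl))
      ((MvPolynomial.continuous_eval p).comp hl) ?_
    intro t ht
    have htU : (fun j => x j + t * (u j - x j)) ∈ U := by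
      by_contra hn
      have : (fun j => x j + t * (u j - x j)) ∈ Set.univ \ U := ⟨trivial, hn⟩
      rw [he] at this
      apply ht.2
      show R.eval t = 0
      rw [hR, lineP_eval]
      exact this i
    show g _ * _ = _
    rw [hpq _ htU, div_mul_cancel₀ _ (hq _ htU)]
  have := congrFun key 0
  simpa using this

lemma restrict {n : ℕ} (g : (Fin n → ℝ) → ℝ) (hg : IsRegulous g) (V : Set (Fin n → ℝ))
    (hV : V.Nonempty) : ∃ a b : MvPolynomial (Fin n) ℝ, (∃ v ∈ V, MvPolynomial.eval v b ≠ 0) ∧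
      ∀ v ∈ V, g v * MvPolynomial.eval v b = MvPolynomial.eval v a := by
  classical
  obtain ⟨p, q, u0, hu0, hpq⟩ := regulous_global g hg
  obtain ⟨v0, hv0⟩ := hV
  set u : Fin n → ℝ := fun j => u0 j - v0 j with hu
  have hex : ∃ k, ∃ v ∈ V, MvPolynomial.eval v ((lineP u q).coeff k) ≠ 0 := by
    by_contra hn
    push Not at hn
    have h1 := lineP_eval u v0 1 q
    have h2 : (lineP u q).map (MvPolynomial.eval v0) = 0 := by
      ext k
      rw [Polynomial.coeff_map]
      simpa using hn k v0 hv0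
    rw [h2] at h1
    simp [hu] at h1
    exact hu0 h1.symm
  refine ⟨(lineP u p).coeff (Nat.find hex), (lineP u q).coeff (Nat.find hex),
    Nat.find_spec hex, fun v hv => ?_⟩
  have hl : Continuous fun t : ℝ => (fun j => v j + t * u j) := by fun_prop
  have := coeff_quot (Nat.find hex) ((lineP u p).map (MvPolynomial.eval v))
    ((lineP u q).map (MvPolynomial.eval v)) (fun t => g (fun j => v j + t * u j))
    (hg.1.comp hl) (fun t => by rw [lineP_eval, lineP_eval, hpq]) (fun j hj => by
      have := Nat.find_min hex hj
      push Not at this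
      rw [Polynomial.coeff_map]
      exact this v hv)
  rw [Polynomial.coeff_map, Polynomial.coeff_map] at this
  simpa using this.symm

lemma sign_poly {n : ℕ} (g : (Fin n → ℝ) → ℝ) (hg : IsRegulous g) (V : Set (Fin n → ℝ))
    (hV : V.Nonempty) : ∃ p : MvPolynomial (Fin n) ℝ, (∃ v ∈ V, MvPolynomial.eval v p ≠ 0) ∧
      ∀ v ∈ V, MvPolynomial.eval v p ≠ 0 →
        (0 < MvPolynomial.eval v p ∧ 0 < g v) ∨ (MvPolynomial.eval v p < 0 ∧ g v ≤ 0) := by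
  by_cases h : ∃ p : MvPolynomial (Fin n) ℝ, (∃ v ∈ V, MvPolynomial.eval v p ≠ 0) ∧
      ∀ v ∈ V, ∃ c : ℝ, 0 ≤ c ∧ MvPolynomial.eval v p = c * g v
  · obtain ⟨p, h1, h2⟩ := h
    refine ⟨p, h1, fun v hv hp => ?_⟩
    obtain ⟨c, hc, hpc⟩ := h2 v hv
    have hc' : 0 < c := by
      rcases hc.lt_or_eq with h | h
      · exact h
      · rw [← h, zero_mul] at hpc; exact (hp hpc).elim
    rcases lt_or_ge 0 (g v) with h | h
    · left; exact ⟨by rw [hpc]; positivity, h⟩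
    · right
      refine ⟨lt_of_le_of_ne ?_ hp, h⟩
      rw [hpc]; nlinarith
  · obtain ⟨a, b, ⟨w, hw, hwb⟩, hab⟩ := restrict g hg V hV
    refine ⟨-(b ^ 2), ⟨w, hw, by simpa using hwb⟩, fun v hv hp => ?_⟩
    have hb : MvPolynomial.eval v b ≠ 0 := by
      intro h0; apply hp; simp [h0]
    right
    constructor
    · have : 0 < MvPolynomial.eval v b ^ 2 := by positivity
      simpa using this
    · by_contra hpos
      push Not at hpos
      apply h
      refine ⟨a * b, ⟨v, hv, ?_⟩, fun y hy => ⟨MvPolynomial.eval y b ^ 2, sq_nonneg _, ?_⟩⟩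
      · rw [map_mul, ← hab v hv]
        have := hpos.ne'
        positivity
      · rw [map_mul, ← hab y hy]; ring

lemma main_ind {n : ℕ} (g : (Fin n → ℝ) → ℝ) (hg : IsRegulous g) (X : Set (Fin n → ℝ))
    (hX : IsRealAlgebraicSet X) (h : MvPolynomial (Fin n) ℝ)
    (hh : ∀ x, 0 ≤ MvPolynomial.eval x h)
    (hopen : ∀ x ∈ X, MvPolynomial.eval x h ≠ 0 → g x ≤ 0 → x ∉ closure {y ∈ X | 0 < g y})
    (I : Ideal (MvPolynomial (Fin n) ℝ)) :
    ∃ P : MvPolynomial (Fin n) ℝ, ∀ x ∈ X, (∀ q ∈ I, MvPolynomial.eval x q = 0) →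
      MvPolynomial.eval x h ≠ 0 → (0 < g x → 0 < MvPolynomial.eval x P) ∧
        (g x ≤ 0 → MvPolynomial.eval x P < 0) := by
  classical
  induction I using WellFoundedGT.induction with
  | ind I ih =>
  rcases Set.eq_empty_or_nonempty {x : Fin n → ℝ | ∀ q ∈ I, MvPolynomial.eval x q = 0} with he | hne
  · refine ⟨1, fun x _ hx _ => ?_⟩
    have : x ∈ {x : Fin n → ℝ | ∀ q ∈ I, MvPolynomial.eval x q = 0} := hx
    rw [he] at this; exact this.elim
  obtain ⟨p, ⟨w, hw, hwp⟩, hp⟩ := sign_poly g hg _ hne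
  have hlt : I < I ⊔ Ideal.span {p} := by
    refine lt_of_le_of_ne le_sup_left fun heq => ?_
    have : p ∈ I := by
      rw [heq]
      exact Ideal.mem_sup_right (Ideal.mem_span_singleton_self p)
    exact hwp (hw p this)
  obtain ⟨q, hq⟩ := ih _ hlt
  have hq' : ∀ x ∈ X, (∀ q ∈ I, MvPolynomial.eval x q = 0) → MvPolynomial.eval x p = 0 →
      MvPolynomial.eval x h ≠ 0 → (0 < g x → 0 < MvPolynomial.eval x q) ∧
        (g x ≤ 0 → MvPolynomial.eval x q < 0) := by
    intro x hx hxI hxp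
    refine hq x hx ?_
    have : I ⊔ Ideal.span {p} ≤ RingHom.ker (MvPolynomial.eval x) := by
      refine sup_le (fun r hr => hxI r hr) ?_
      rw [Ideal.span_le]
      rintro _ rfl
      exact hxp
    exact fun r hr => this hr
  obtain ⟨G0, hG0⟩ : I.FG := IsNoetherian.noetherian I
  obtain ⟨k, e, he⟩ := hX
  have hXmem : ∀ x, x ∈ X ↔ ∀ i, MvPolynomial.eval x (e i) = 0 := fun x => by rw [he]; rfl
  have hImem : ∀ x, (∀ r ∈ I, MvPolynomial.eval x r = 0) ↔ ∀ r ∈ G0, MvPolynomial.eval x r = 0 := by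
    intro x
    constructor
    · intro hx r hr
      exact hx r (by rw [← hG0]; exact Submodule.subset_span hr)
    · intro hx r hr
      have : Ideal.span (G0 : Set (MvPolynomial (Fin n) ℝ)) ≤ RingHom.ker (MvPolynomial.eval x) := by
        rw [Ideal.span_le]
        exact fun r hr => hx r hr
      exact this (by rw [← hG0] at hr; exact hr)
  set S : Set (Fin n → ℝ) := {x | x ∈ X ∧ (∀ r ∈ I, MvPolynomial.eval x r = 0) ∧
    MvPolynomial.eval x h ≠ 0 ∧ MvPolynomial.eval x p ≠ 0 ∧
    MvPolynomial.eval x p * MvPolynomial.eval x q ≤ 0} with hS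
  have hloj := loj (G0 ∪ Finset.univ.image e ∪ {h, p, q}) S ?_ h p ?_ ?_ ?_
  · obtain ⟨N, c, hc, hN⟩ := hloj
    refine ⟨MvPolynomial.C c * ((1 + ∑ i, MvPolynomial.X i ^ 2) * h + 1) ^ N *
      (1 + p ^ 2 * q ^ 2) * p + h ^ N * q, fun x hx hxI hxh => ?_⟩
    have hev : MvPolynomial.eval x (MvPolynomial.C c * ((1 + ∑ i, MvPolynomial.X i ^ 2) * h + 1) ^ N *
      (1 + p ^ 2 * q ^ 2) * p + h ^ N * q) = c * ((1 + ∑ i, x i ^ 2) * MvPolynomial.eval x h + 1) ^ N *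
      (1 + MvPolynomial.eval x p ^ 2 * MvPolynomial.eval x q ^ 2) * MvPolynomial.eval x p +
      MvPolynomial.eval x h ^ N * MvPolynomial.eval x q := by simp
    have hq'' := hq' x hx hxI
    have hp'' := hp x hxI
    have hNx := hN x
    have hSx : x ∈ S ↔ x ∈ X ∧ (∀ r ∈ I, MvPolynomial.eval x r = 0) ∧
      MvPolynomial.eval x h ≠ 0 ∧ MvPolynomial.eval x p ≠ 0 ∧
      MvPolynomial.eval x p * MvPolynomial.eval x q ≤ 0 := Iff.rfl
    have hhx : 0 < MvPolynomial.eval x h := lt_of_le_of_ne (hh x) hxh.symm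
    rw [hev]
    generalize MvPolynomial.eval x p = a at *
    generalize MvPolynomial.eval x q = b at *
    have hs0 : 0 ≤ ∑ i, x i ^ 2 := Finset.sum_nonneg fun i _ => sq_nonneg _
    have hBpos : 0 < c * ((1 + ∑ i, x i ^ 2) * MvPolynomial.eval x h + 1) ^ N := by positivity
    have hhN : 0 < MvPolynomial.eval x h ^ N := by positivity
    rw [← mul_assoc] at hNx
    generalize c * ((1 + ∑ i, x i ^ 2) * MvPolynomial.eval x h + 1) ^ N = B at *
    generalize MvPolynomial.eval x h ^ N = H at *
    by_cases ha : a = 0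
    · obtain ⟨h1, h2⟩ := hq'' ha hxh
      subst ha
      constructor
      · intro hgx
        have := h1 hgx
        simp only [mul_zero, zero_add]; positivity
      · intro hgx
        have := h2 hgx
        simp only [mul_zero, zero_add]; nlinarith
    · have ha2 : 0 < a ^ 2 := by positivity
      have hprod : 0 < a * (B * (1 + a ^ 2 * b ^ 2) * a + H * b) := by
        have e1 : a * (B * (1 + a ^ 2 * b ^ 2) * a + H * b) =
          B * a ^ 2 * (1 + (a * b) ^ 2) + H * (a * b) := by ring
        rw [e1]
        have hBa : 0 < B * a ^ 2 := by positivity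
        rcases le_or_gt (a * b) 0 with hab | hab
        · have h3 := hNx (hSx.2 ⟨hx, hxI, hxh, ha, hab⟩)
          have h4 : B * a ^ 2 * (a * b) ≤ H * (a * b) := mul_le_mul_of_nonpos_right h3 hab
          have h5 : 0 < B * a ^ 2 * (1 + (a * b) ^ 2 + a * b) :=
            mul_pos hBa (by nlinarith [sq_nonneg (a * b + 1)])
          nlinarith
        · positivity
      rcases hp'' ha with ⟨h1, h2⟩ | ⟨h1, h2⟩
      · exact ⟨fun _ => (mul_pos_iff_of_pos_left h1).1 hprod, fun h3 => by linarith⟩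
      · exact ⟨fun h3 => by linarith, fun _ => neg_of_mul_pos_right hprod h1.le⟩
  · intro x y hxy hxS
    have hz : ∀ r ∈ G0 ∪ Finset.univ.image e ∪ {h, p, q},
        (MvPolynomial.eval x r = 0 ↔ MvPolynomial.eval y r = 0) := by
      intro r hr
      rw [← sign_eq_zero_iff, hxy r hr, sign_eq_zero_iff]
    obtain ⟨h1, h2, h3, h4, h5⟩ := hxS
    refine ⟨?_, ?_, ?_, ?_, ?_⟩
    · rw [hXmem] at h1 ⊢
      intro i
      exact (hz _ (by simp)).1 (h1 i)
    · rw [hImem] at h2 ⊢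
      intro r hr
      exact (hz _ (by simp [hr])).1 (h2 r hr)
    · rwa [Ne, ← hz _ (by simp)]
    · rwa [Ne, ← hz _ (by simp)]
    · have : SignType.sign (MvPolynomial.eval y p * MvPolynomial.eval y q) =
        SignType.sign (MvPolynomial.eval x p * MvPolynomial.eval x q) := by
        rw [sign_mul, sign_mul, hxy p (by simp), hxy q (by simp)]
      by_contra hpos
      push Not at hpos
      rw [sign_pos hpos] at this
      have := sign_eq_one_iff.1 this.symm
      linarith
  · intro x hx
    exact lt_of_le_of_ne (hh x) hx.2.2.1.symm
  · intro x hx hxh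
    have hcev : ∀ r : MvPolynomial (Fin n) ℝ, Continuous fun x : Fin n → ℝ => MvPolynomial.eval x r :=
      fun r => MvPolynomial.continuous_eval r
    have hzero : ∀ r : MvPolynomial (Fin n) ℝ, (∀ y ∈ S, MvPolynomial.eval y r = 0) →
        MvPolynomial.eval x r = 0 := by
      intro r hr
      have : closure S ⊆ {y | MvPolynomial.eval y r = 0} :=
        closure_minimal hr (isClosed_eq (hcev r) continuous_const)
      exact this hx
    have hxX : x ∈ X := by
      rw [hXmem]
      intro i
      exact hzero _ fun y hy => (hXmem y).1 hy.1 i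
    have hxI : ∀ r ∈ I, MvPolynomial.eval x r = 0 := fun r hr => hzero r fun y hy => hy.2.1 r hr
    have hxpq : MvPolynomial.eval x p * MvPolynomial.eval x q ≤ 0 := by
      have : closure S ⊆ {y | MvPolynomial.eval y p * MvPolynomial.eval y q ≤ 0} :=
        closure_minimal (fun y hy => hy.2.2.2.2)
          (isClosed_le ((hcev p).mul (hcev q)) continuous_const)
      exact this hx
    refine ⟨hxX, hxI, hxh, fun hxp => ?_, hxpq⟩
    obtain ⟨h1, h2⟩ := hq' x hxX hxI hxp hxh
    rw [mem_closure_iff] at hx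
    rcases lt_or_ge 0 (g x) with hgx | hgx
    · obtain ⟨y, ⟨hy1, hy2⟩, hyS⟩ := hx ({y | 0 < MvPolynomial.eval y q} ∩ {y | 0 < g y})
        ((isOpen_lt continuous_const (hcev q)).inter (isOpen_lt continuous_const hg.1))
        ⟨h1 hgx, hgx⟩
      obtain ⟨_, b2, _, b4, b5⟩ := hyS
      have hy1' : 0 < MvPolynomial.eval y q := hy1
      have hy2' : 0 < g y := hy2
      rcases hp y b2 b4 with ⟨c1, c2⟩ | ⟨c1, c2⟩
      · nlinarith [mul_pos c1 hy1']
      · linarith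
    · obtain ⟨y, ⟨hy1, hy2⟩, hyS⟩ := hx
        ({y | MvPolynomial.eval y q < 0} ∩ (closure {y ∈ X | 0 < g y})ᶜ)
        ((isOpen_lt (hcev q) continuous_const).inter isClosed_closure.isOpen_compl)
        ⟨h2 hgx, hopen x hxX hxh hgx⟩
      obtain ⟨b1, b2, _, b4, b5⟩ := hyS
      have hy1' : MvPolynomial.eval y q < 0 := hy1
      rcases hp y b2 b4 with ⟨c1, c2⟩ | ⟨c1, c2⟩
      · exact hy2 (subset_closure ⟨b1, c2⟩)
      · nlinarith [mul_pos_of_neg_of_neg c1 hy1']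
  · intro x hx
    exact hx.2.2.2.1

/-- for `f` regulous on `X` and `S = {f > 0}`, `S` is principal open iff
`S ∩ Zar(Bd(S)) = ∅`. -/
theorem regulous_principal_iff_boundary {n : ℕ} (X : Set (Fin n → ℝ))
    (hX : IsRealAlgebraicSet X) (f : (Fin n → ℝ) → ℝ) (hf : IsRegulousOn X f) :
    (∃ p : MvPolynomial (Fin n) ℝ,
        {x ∈ X | 0 < f x} = {x ∈ X | 0 < MvPolynomial.eval x p}) ↔
      {x ∈ X | 0 < f x} ∩ zarClosureIn X (bdIn X {x ∈ X | 0 < f x}) = ∅ := by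
  classical
  obtain ⟨g, hg, hfg⟩ := hf
  have hSg : {x ∈ X | 0 < f x} = {x ∈ X | 0 < g x} := by
    ext x
    constructor
    · rintro ⟨h1, h2⟩
      exact ⟨h1, by rwa [← hfg x h1]⟩
    · rintro ⟨h1, h2⟩
      exact ⟨h1, by rwa [hfg x h1]⟩
  rw [hSg]
  constructor
  · rintro ⟨p, hp⟩
    rw [hp]
    have hcp : Continuous fun x : Fin n → ℝ => MvPolynomial.eval x p :=
      MvPolynomial.continuous_eval p
    have hmem : ({x ∈ X | MvPolynomial.eval x p = 0} : Set (Fin n → ℝ)) ∈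
        {V | IsZariskiClosedIn X V ∧ bdIn X {x ∈ X | 0 < MvPolynomial.eval x p} ⊆ V} := by
      refine ⟨⟨?_, fun x hx => hx.1⟩, ?_⟩
      · obtain ⟨k, e, he⟩ := hX
        refine ⟨k + 1, Fin.cons p e, ?_⟩
        ext x
        have : x ∈ X ↔ ∀ i, MvPolynomial.eval x (e i) = 0 := by rw [he]; rfl
        simp only [Set.mem_setOf_eq, Fin.forall_fin_succ, Fin.cons_zero, Fin.cons_succ, this]
        tauto
      · rintro x ⟨⟨hx1, hx2⟩, hx3⟩
        refine ⟨hx2, ?_⟩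
        have h0 : 0 ≤ MvPolynomial.eval x p := by
          have : closure {x ∈ X | 0 < MvPolynomial.eval x p} ⊆ {y | 0 ≤ MvPolynomial.eval y p} :=
            closure_minimal (fun y hy => le_of_lt hy.2) (isClosed_le continuous_const hcp)
          exact this hx1
        by_contra hne
        apply hx3
        refine ⟨hx2, {y | 0 < MvPolynomial.eval y p}, isOpen_lt continuous_const hcp,
          lt_of_le_of_ne h0 (Ne.symm hne), ?_⟩
        rintro y ⟨hy1, hy2⟩
        exact ⟨hy2, hy1⟩
    rw [Set.eq_empty_iff_forall_notMem]
    rintro x ⟨⟨_, hx1⟩, hx2⟩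
    have := (hx2 _ hmem).2
    linarith
  · intro hempty
    obtain ⟨G0, hG0⟩ : (vanishingIdealOf (bdIn X {x ∈ X | 0 < g x})).FG :=
      IsNoetherian.noetherian _
    set h : MvPolynomial (Fin n) ℝ := ∑ r ∈ G0, r ^ 2 with hh
    have hhe : ∀ x, MvPolynomial.eval x h = ∑ r ∈ G0, MvPolynomial.eval x r ^ 2 := by
      intro x; simp [hh]
    have hh0 : ∀ x, 0 ≤ MvPolynomial.eval x h := fun x => by
      rw [hhe]; exact Finset.sum_nonneg fun r _ => sq_nonneg _
    have hbd0 : ∀ x ∈ bdIn X {x ∈ X | 0 < g x}, MvPolynomial.eval x h = 0 := by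
      intro x hx
      rw [hhe]
      refine Finset.sum_eq_zero fun r hr => ?_
      have : r ∈ vanishingIdealOf (bdIn X {x ∈ X | 0 < g x}) := by
        rw [← hG0]; exact Submodule.subset_span hr
      have := this x hx
      rw [this]; ring
    have hSh : ∀ x ∈ X, 0 < g x → MvPolynomial.eval x h ≠ 0 := by
      intro x hxX hgx hhx
      have hxG : ∀ r ∈ G0, MvPolynomial.eval x r = 0 := by
        intro r hr
        rw [hhe, Finset.sum_eq_zero_iff_of_nonneg (fun r _ => sq_nonneg _)] at hhx
        exact pow_eq_zero_iff (two_ne_zero) |>.1 (hhx r hr)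
      have hker : Ideal.span (G0 : Set (MvPolynomial (Fin n) ℝ)) ≤
          RingHom.ker (MvPolynomial.eval x) := by
        rw [Ideal.span_le]
        exact fun r hr => hxG r hr
      have : x ∈ {x ∈ X | 0 < g x} ∩ zarClosureIn X (bdIn X {x ∈ X | 0 < g x}) := by
        refine ⟨⟨hxX, hgx⟩, ?_⟩
        rintro V ⟨⟨⟨k, e, he⟩, _⟩, hV⟩
        rw [he]
        intro i
        apply hker
        have : e i ∈ vanishingIdealOf (bdIn X {x ∈ X | 0 < g x}) := by
          intro y hy
          have := hV hy
          rw [he] at this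
          exact this i
        rw [← hG0] at this
        exact this
      rw [hempty] at this
      exact this
    obtain ⟨P, hP⟩ := main_ind g hg X hX h hh0 (by
      intro x hx hxh hgx hcl
      apply hxh
      apply hbd0
      refine ⟨⟨hcl, hx⟩, ?_⟩
      rintro ⟨_, U, _, hxU, hUX⟩
      have := (hUX ⟨hxU, hx⟩).2
      linarith) ⊥
    refine ⟨h * P, ?_⟩
    ext x
    constructor
    · rintro ⟨hx, hgx⟩
      have h1 := hSh x hx hgx
      have h2 := (hP x hx (by intro q hq; rw [Ideal.mem_bot.1 hq, map_zero]) h1).1 hgx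
      have h3 : 0 < MvPolynomial.eval x h := lt_of_le_of_ne (hh0 x) h1.symm
      refine ⟨hx, ?_⟩
      rw [map_mul]; positivity
    · rintro ⟨hx, hpos⟩
      refine ⟨hx, ?_⟩
      by_contra hgx
      push Not at hgx
      rw [map_mul] at hpos
      have h1 : MvPolynomial.eval x h ≠ 0 := by
        intro h0; rw [h0, zero_mul] at hpos; exact lt_irrefl _ hpos
      have h2 := (hP x hx (by intro q hq; rw [Ideal.mem_bot.1 hq, map_zero]) h1).2 hgx
      nlinarith [hh0 x]
end
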